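/- arXiv:2103.12600 — 3 statements merged into one kernel-verified Lean document; each statement's English description precedes it below -/
import Mathlib

section
/- Under the stated hypotheses, let s⁺ := max_{Ω̄×Ω̄} s and, for a constant σ ∈ (0,1), let [u]_{q(.),σ,Ω} denote the Gagliardo seminorm with the constant order σ in place of s(x,y). Then there exist constants C₁, C₂ > 0 such that for every u ∈ H_0^{s(.)}(Ω) that is compactly supported inside Ω one has [u]_{q(.),s⁻,Ω} ≤ C₁ [u]_{q(.),s(.),Ω} and [u]_{q(.),s(.),Ω} ≤ C₂ [u]_{q(.),s⁺,Ω}; that is, the embeddings H_0^{s⁺}(Ω) ↪ H_0^{s(.)}(Ω) ↪ H_0^{s⁻}(Ω) are continuous on compactly supported functions. -/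
open MeasureTheory Filter Topology
open scoped ENNReal

noncomputable section

/-- The variable-exponent modular `ϱ_{a(·)}(u) = ∫_Ω |u(x)|^{a(x)} dx`, computed as a
Lebesgue integral in `ℝ≥0∞` (used to express finiteness of the modular). -/
def modularE {n : ℕ} (Ω : Set (Fin n → ℝ)) (a u : (Fin n → ℝ) → ℝ) : ℝ≥0∞ :=
  ∫⁻ x in Ω, ENNReal.ofReal (|u x| ^ a x)

/-- Membership in the variable-exponent Lebesgue space `L^{a(·)}(Ω)`. -/
def MemVarLp {n : ℕ} (Ω : Set (Fin n → ℝ)) (a u : (Fin n → ℝ) → ℝ) : Prop :=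
  Measurable u ∧ modularE Ω a u < ⊤

/-- The Luxemburg norm on `L^{a(·)}(Ω)`. -/
def luxNorm {n : ℕ} (Ω : Set (Fin n → ℝ)) (a u : (Fin n → ℝ) → ℝ) : ℝ :=
  sInf {l : ℝ | 0 < l ∧ (∫⁻ x in Ω, ENNReal.ofReal (|u x / l| ^ a x)) ≤ 1}

/-- The variable-exponent Gagliardo modular with scaling parameter `l`. -/
def gagModE {n : ℕ} (Ω : Set (Fin n → ℝ)) (q s : (Fin n → ℝ) → (Fin n → ℝ) → ℝ)
    (u : (Fin n → ℝ) → ℝ) (l : ℝ) : ℝ≥0∞ :=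
  ∫⁻ x in Ω, ∫⁻ y in Ω,
    ENNReal.ofReal (|(u x - u y) / l| ^ q x y / dist x y ^ ((n : ℝ) + q x y * s x y))

/-- The variable-exponent Gagliardo seminorm `[u]_{q(·),s(·),Ω}`. -/
def gagSemi {n : ℕ} (Ω : Set (Fin n → ℝ)) (q s : (Fin n → ℝ) → (Fin n → ℝ) → ℝ)
    (u : (Fin n → ℝ) → ℝ) : ℝ :=
  sInf {l : ℝ | 0 < l ∧ gagModE Ω q s u l < 1}

/-- Finiteness of the Gagliardo seminorm, `[u]_{q(·),s(·),Ω} < ∞`. -/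
def GagFinite {n : ℕ} (Ω : Set (Fin n → ℝ)) (q s : (Fin n → ℝ) → (Fin n → ℝ) → ℝ)
    (u : (Fin n → ℝ) → ℝ) : Prop :=
  ∃ l : ℝ, 0 < l ∧ gagModE Ω q s u l < 1

/-- Membership in the variable-order fractional Sobolev space `H_0^{p(·),q(·),s(·)}(Ω)`:
measurable, vanishing a.e. outside `Ω`, with finite Luxemburg norm and finite
Gagliardo seminorm. -/
def MemH0 {n : ℕ} (Ω : Set (Fin n → ℝ)) (p : (Fin n → ℝ) → ℝ)
    (q s : (Fin n → ℝ) → (Fin n → ℝ) → ℝ) (u : (Fin n → ℝ) → ℝ) : Prop :=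
  Measurable u ∧ (∀ᵐ (x : Fin n → ℝ) ∂volume, x ∉ Ω → u x = 0) ∧
    MemVarLp Ω p u ∧ GagFinite Ω q s u

theorem gagModE_mono_aux {n : ℕ} (Ω : Set (Fin n → ℝ)) (hΩ : MeasurableSet Ω)
    (q s₁ s₂ : (Fin n → ℝ) → (Fin n → ℝ) → ℝ) (D : ℝ) (hD : 1 ≤ D)
    (hdist : ∀ x ∈ Ω, ∀ y ∈ Ω, dist x y ≤ D)
    (hq : ∀ x ∈ Ω, ∀ y ∈ Ω, 0 < q x y)
    (h12 : ∀ x ∈ Ω, ∀ y ∈ Ω, s₁ x y ≤ s₂ x y)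
    (h21 : ∀ x ∈ Ω, ∀ y ∈ Ω, s₂ x y - s₁ x y ≤ 1)
    (u : (Fin n → ℝ) → ℝ) (l : ℝ) :
    gagModE Ω q s₁ u (D * l) ≤ gagModE Ω q s₂ u l := by
  unfold gagModE
  refine setLIntegral_mono' hΩ fun x hx => setLIntegral_mono' hΩ fun y hy => ?_
  apply ENNReal.ofReal_le_ofReal
  have hq0 := hq x hx y hy
  have hD0 : 0 < D := by linarith
  rcases eq_or_ne x y with rfl | hxy
  · simp [Real.zero_rpow hq0.ne']
  have hd : 0 < dist x y := dist_pos.mpr hxy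
  have e1 : |(u x - u y) / (D * l)| = |(u x - u y) / l| / D := by
    rw [mul_comm, ← div_div, abs_div, abs_of_pos hD0]
  rw [e1, Real.div_rpow (abs_nonneg _) hD0.le, div_div]
  apply div_le_div_of_nonneg_left (Real.rpow_nonneg (abs_nonneg _) _) (by positivity)
  have e2 : (n : ℝ) + q x y * s₂ x y = q x y * (s₂ x y - s₁ x y) + (n + q x y * s₁ x y) := by
    ring
  rw [e2, Real.rpow_add hd]
  apply mul_le_mul_of_nonneg_right _ (by positivity)
  have h1 := h12 x hx y hy
  have h2 := h21 x hx y hy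
  calc dist x y ^ (q x y * (s₂ x y - s₁ x y)) ≤ D ^ (q x y * (s₂ x y - s₁ x y)) :=
        Real.rpow_le_rpow hd.le (hdist x hx y hy) (mul_nonneg hq0.le (by linarith))
    _ ≤ D ^ q x y := Real.rpow_le_rpow_of_exponent_le hD (by nlinarith)

theorem gagSemi_mono_aux {n : ℕ} (Ω : Set (Fin n → ℝ)) (hΩ : MeasurableSet Ω)
    (q s₁ s₂ : (Fin n → ℝ) → (Fin n → ℝ) → ℝ) (D : ℝ) (hD : 1 ≤ D)
    (hdist : ∀ x ∈ Ω, ∀ y ∈ Ω, dist x y ≤ D)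
    (hq : ∀ x ∈ Ω, ∀ y ∈ Ω, 0 < q x y)
    (h12 : ∀ x ∈ Ω, ∀ y ∈ Ω, s₁ x y ≤ s₂ x y)
    (h21 : ∀ x ∈ Ω, ∀ y ∈ Ω, s₂ x y - s₁ x y ≤ 1)
    (u : (Fin n → ℝ) → ℝ) (hf : GagFinite Ω q s₂ u) :
    GagFinite Ω q s₁ u ∧ gagSemi Ω q s₁ u ≤ D * gagSemi Ω q s₂ u := by
  have hD0 : 0 < D := by linarith
  have key : ∀ l, 0 < l → gagModE Ω q s₂ u l < 1 → gagModE Ω q s₁ u (D * l) < 1 :=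
    fun l _ h => (gagModE_mono_aux Ω hΩ q s₁ s₂ D hD hdist hq h12 h21 u l).trans_lt h
  obtain ⟨l, hl, hm⟩ := hf
  refine ⟨⟨D * l, by positivity, key l hl hm⟩, ?_⟩
  rw [mul_comm, ← div_le_iff₀ hD0]
  refine le_csInf ⟨l, hl, hm⟩ ?_
  rintro k ⟨hk, hkm⟩
  rw [div_le_iff₀ hD0, mul_comm]
  exact csInf_le ⟨0, fun z hz => hz.1.le⟩ ⟨by positivity, key k hk hkm⟩

/-- On compactly supported functions the embeddings
`H_0^{s⁺}(Ω) ↪ H_0^{s(·)}(Ω) ↪ H_0^{s⁻}(Ω)` are continuous. -/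
theorem statement5
    {n : ℕ} (hn : 1 ≤ n)
    (Ω : Set (Fin n → ℝ)) (hΩo : IsOpen Ω) (hΩb : Bornology.IsBounded Ω)
    (hΩne : Ω.Nonempty)
    (p : (Fin n → ℝ) → ℝ) (hpc : ContinuousOn p (closure Ω))
    (pm pM : ℝ) (hpm2 : 2 < pm)
    (hpbd : ∀ x ∈ closure Ω, pm ≤ p x ∧ p x ≤ pM)
    (M : ℝ) (hM : 0 < M)
    (hplog : ∀ x ∈ closure Ω, ∀ y ∈ closure Ω,
      dist x y < 1 / 2 → |p x - p y| ≤ M / |Real.log (dist x y)|)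
    (q : (Fin n → ℝ) → (Fin n → ℝ) → ℝ)
    (hqc : Continuous fun z : (Fin n → ℝ) × (Fin n → ℝ) => q z.1 z.2)
    (hqsym : ∀ x y, q x y = q y x)
    (hqtr : ∀ x y z, q (x - z) (y - z) = q x y)
    (qm qM : ℝ) (hqm : 1 < qm)
    (hqbd : ∀ x ∈ closure Ω, ∀ y ∈ closure Ω, qm ≤ q x y ∧ q x y ≤ qM)
    (hqMpm : qM < pm)
    (s : (Fin n → ℝ) → (Fin n → ℝ) → ℝ)
    (hsc : Continuous fun z : (Fin n → ℝ) × (Fin n → ℝ) => s z.1 z.2)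
    (hssym : ∀ x y, s x y = s y x)
    (hs01 : ∀ x y, 0 < s x y ∧ s x y < 1)
    (sm : ℝ) (hsmle : ∀ x ∈ closure Ω, ∀ y ∈ closure Ω, sm ≤ s x y)
    (hsmmem : ∃ x ∈ closure Ω, ∃ y ∈ closure Ω, s x y = sm)
    (hnsq : ∀ x ∈ closure Ω, ∀ y ∈ closure Ω, sm * q x y < (n : ℝ))
    (hpq : ∀ x ∈ closure Ω, q x x < p x)
    (r : (Fin n → ℝ) → ℝ) (hrc : ContinuousOn r (closure Ω))
    (hr1 : ∀ x ∈ closure Ω, 1 < r x)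
    (hrsub : ∀ x ∈ closure Ω, r x < (n : ℝ) * q x x / ((n : ℝ) - sm * q x x))
    (sM : ℝ) (hsMge : ∀ x ∈ closure Ω, ∀ y ∈ closure Ω, s x y ≤ sM)
    (hsMmem : ∃ x ∈ closure Ω, ∃ y ∈ closure Ω, s x y = sM) :
    (∃ C₁ : ℝ, 0 < C₁ ∧ ∀ u : (Fin n → ℝ) → ℝ, MemH0 Ω p q s u →
      HasCompactSupport u → tsupport u ⊆ Ω →
      GagFinite Ω q (fun _ _ => sm) u ∧
        gagSemi Ω q (fun _ _ => sm) u ≤ C₁ * gagSemi Ω q s u) ∧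
    (∃ C₂ : ℝ, 0 < C₂ ∧ ∀ u : (Fin n → ℝ) → ℝ, Measurable u →
      (∀ᵐ (x : Fin n → ℝ) ∂volume, x ∉ Ω → u x = 0) → MemVarLp Ω p u →
      HasCompactSupport u → tsupport u ⊆ Ω → GagFinite Ω q (fun _ _ => sM) u →
      GagFinite Ω q s u ∧
        gagSemi Ω q s u ≤ C₂ * gagSemi Ω q (fun _ _ => sM) u) := by
  obtain ⟨D₀, hD₀⟩ := Metric.isBounded_iff.1 hΩb
  have hcl : ∀ x ∈ Ω, x ∈ closure Ω := fun x hx => subset_closure hx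
  have hdist : ∀ x ∈ Ω, ∀ y ∈ Ω, dist x y ≤ max D₀ 1 :=
    fun x hx y hy => (hD₀ hx hy).trans (le_max_left _ _)
  have hq : ∀ x ∈ Ω, ∀ y ∈ Ω, 0 < q x y := fun x hx y hy => by
    linarith [(hqbd x (hcl x hx) y (hcl y hy)).1]
  have hsm0 : 0 < sm := by
    obtain ⟨x, _, y, _, h⟩ := hsmmem
    exact h ▸ (hs01 x y).1
  have hsM1 : sM < 1 := by
    obtain ⟨x, _, y, _, h⟩ := hsMmem
    exact h ▸ (hs01 x y).2
  have hpos : 0 < max D₀ 1 := lt_max_of_lt_right one_pos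
  refine ⟨⟨max D₀ 1, hpos, fun u hu _ _ => ?_⟩, ⟨max D₀ 1, hpos, fun u _ _ _ _ _ hf => ?_⟩⟩
  · exact gagSemi_mono_aux Ω hΩo.measurableSet q (fun _ _ => sm) s _ (le_max_right _ _) hdist hq
      (fun x hx y hy => hsmle x (hcl x hx) y (hcl y hy))
      (fun x hx y hy => by linarith [(hs01 x y).2]) u hu.2.2.2
  · exact gagSemi_mono_aux Ω hΩo.measurableSet q s (fun _ _ => sM) _ (le_max_right _ _) hdist hq
      (fun x hx y hy => hsMge x (hcl x hx) y (hcl y hy))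
      (fun x hx y hy => by linarith [(hs01 x y).1]) u hf
end
end

section
/- Let E be a real Banach space and J : E → ℝ a continuously Fréchet differentiable functional with J(0) = 0. Assume: (i) there exist ρ > 0 and δ > 0 such that J(u) ≥ δ for all u ∈ E with ‖u‖ = ρ; (ii) there exists e ∈ E with ‖e‖ > ρ and J(e) < 0. Let Γ = {γ ∈ C([0,1]; E) : γ(0) = 0 and γ(1) = e} and c = inf_{γ∈Γ} max_{0≤σ≤1} J(γ(σ)). Then c ≥ δ, and there exists a sequence {u_j} ⊂ E with J(u_j) → c and ‖J′(u_j)‖_{E*} → 0 as j → ∞ (a Palais–Smale sequence at level c). -/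
open Filter Topology

theorem ekeland_aux {X : Type*} [MetricSpace X] [CompleteSpace X] (Φ : X → ℝ)
    (hΦ : Continuous Φ) (b : ℝ) (hb : ∀ x, b ≤ Φ x) (ε : ℝ) (hε : 0 < ε) (x₀ : X) :
    ∃ x, Φ x ≤ Φ x₀ ∧ ∀ y, Φ x ≤ Φ y + ε * dist x y := by
  let S : X → Set X := fun x => {y | Φ y + ε * dist x y ≤ Φ x}
  have hself : ∀ x, x ∈ S x := fun x => by simp [S]
  have htrans : ∀ x y z, y ∈ S x → z ∈ S y → z ∈ S x := by
    intro x y z h1 h2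
    simp only [S, Set.mem_ofPred_eq] at *
    nlinarith [dist_triangle x y z]
  have hclosed : ∀ x, IsClosed (S x) := fun x =>
    isClosed_le (by fun_prop) continuous_const
  have hstep : ∀ (n : ℕ) (x : X), ∃ y ∈ S x, ∀ z ∈ S x, Φ y ≤ Φ z + (1/2 : ℝ)^n := by
    intro n x
    have hne : (Φ '' S x).Nonempty := ⟨_, x, hself x, rfl⟩
    have hbd : BddBelow (Φ '' S x) := ⟨b, by rintro _ ⟨z, _, rfl⟩; exact hb z⟩
    obtain ⟨_, ⟨y, hy, rfl⟩, hlt⟩ := Real.lt_sInf_add_pos hne (show (0:ℝ) < (1/2 : ℝ)^n by positivity)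
    exact ⟨y, hy, fun z hz => by linarith [csInf_le hbd ⟨z, hz, rfl⟩]⟩
  choose f hfS hf using hstep
  let u : ℕ → X := fun n => Nat.rec x₀ (fun n x => f n x) n
  have hu : ∀ n, u (n+1) = f n (u n) := fun n => rfl
  have hmono : ∀ n k, u (n+k) ∈ S (u n) := by
    intro n k
    induction k with
    | zero => exact hself _
    | succ k ih => exact htrans _ _ _ ih (by rw [← add_assoc, hu]; exact hfS _ _)
  have hsmall : ∀ n, ∀ y ∈ S (u (n+1)), dist (u (n+1)) y ≤ (1/2 : ℝ)^n / ε := by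
    intro n y hy
    have h1 := hf n (u n) y (htrans _ _ _ (hmono n 1) hy)
    rw [← hu] at h1
    simp only [S, Set.mem_ofPred_eq] at hy
    rw [le_div_iff₀ hε]
    linarith
  have hlim : Tendsto (fun n : ℕ => (1/2 : ℝ)^n / ε) atTop (𝓝 0) := by
    simpa using (tendsto_pow_atTop_nhds_zero_of_lt_one (r := (1/2:ℝ)) (by norm_num) (by norm_num)).div_const ε
  have hcau : CauchySeq (fun n => u (n+1)) := by
    refine cauchySeq_of_le_tendsto_0' (fun n : ℕ => (1/2 : ℝ)^n / ε) ?_ hlim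
    intro n m hnm
    obtain ⟨k, rfl⟩ := Nat.exists_eq_add_of_le hnm
    exact hsmall n _ (by have := hmono (n+1) k; rwa [show n + 1 + k = n + k + 1 by ring] at this)
  obtain ⟨x, hx⟩ := cauchySeq_tendsto_of_complete hcau
  have hxS : ∀ n, x ∈ S (u n) := by
    intro n
    refine (hclosed _).mem_of_tendsto hx ?_
    filter_upwards [eventually_ge_atTop n] with m hm
    obtain ⟨k, rfl⟩ := Nat.exists_eq_add_of_le hm
    exact hmono n (k+1)
  refine ⟨x, ?_, ?_⟩
  · have := hxS 0
    simp only [S, Set.mem_ofPred_eq] at this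
    have h0 : u 0 = x₀ := rfl
    rw [h0] at this
    nlinarith [dist_nonneg (x := x₀) (y := x)]
  · intro y
    by_contra hcon
    push Not at hcon
    have hy : y ∈ S x := hcon.le
    have hty : Tendsto (fun n => u (n+1)) atTop (𝓝 y) := by
      rw [tendsto_iff_dist_tendsto_zero]
      exact squeeze_zero (fun _ => dist_nonneg)
        (fun n => hsmall n y (htrans _ _ _ (hxS (n+1)) hy)) hlim
    have := tendsto_nhds_unique hx hty
    subst this
    simp at hcon

theorem field_aux {E : Type*} [NormedAddCommGroup E] [NormedSpace ℝ E]
    (J' : E → E →L[ℝ] ℝ) (hJ'cont : Continuous J')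
    (γ : C(unitInterval, E)) (M : Set unitInterval) (hM : IsClosed M)
    (h0 : 0 ∉ M) (h1 : 1 ∉ M) (ε : ℝ) (hε : 0 < ε) (h : ∀ t ∈ M, ε < ‖J' (γ t)‖) :
    ∃ v : C(unitInterval, E), v 0 = 0 ∧ v 1 = 0 ∧ (∀ t, ‖v t‖ ≤ 1) ∧
      ∀ t ∈ M, J' (γ t) (v t) < -ε := by
  let T : unitInterval → Set E := fun x =>
    {w | ‖w‖ ≤ 1 ∧ (x ∈ M → J' (γ x) w < -ε) ∧ (x = 0 ∨ x = 1 → w = 0)}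
  have hconv : ∀ x, Convex ℝ (T x) := by
    intro x w hw z hz a b ha hb hab
    refine ⟨?_, ?_, ?_⟩
    · have := convex_closedBall (0:E) 1 (by simpa using hw.1) (by simpa using hz.1) ha hb hab
      simpa using this
    · intro hx
      have := convex_Iio (𝕜 := ℝ) (-ε) (hw.2.1 hx) (hz.2.1 hx) ha hb hab
      simpa using this
    · intro hx
      simp [hw.2.2 hx, hz.2.2 hx]
  obtain ⟨g, hg⟩ := exists_continuous_forall_mem_convex_of_local_const hconv (by
    intro x
    by_cases hx : x ∈ M
    · have hex : ∃ w : E, ‖w‖ ≤ 1 ∧ J' (γ x) w < -ε := by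
        by_contra hcon
        push Not at hcon
        refine absurd (h x hx) (not_lt.2 ?_)
        refine ContinuousLinearMap.opNorm_le_of_unit_norm hε.le ?_
        intro w hw
        have a1 := hcon w hw.le
        have a2 := hcon (-w) (by simp [hw])
        simp only [map_neg] at a2
        rw [Real.norm_eq_abs, abs_le]
        constructor <;> linarith
      obtain ⟨w, hw1, hw2⟩ := hex
      refine ⟨w, ?_⟩
      have hc : Continuous fun y => J' (γ y) w := by fun_prop
      have e0 : ∀ᶠ y in 𝓝 x, y ≠ 0 := eventually_ne_nhds (fun hh => h0 (hh ▸ hx))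
      have e1 : ∀ᶠ y in 𝓝 x, y ≠ 1 := eventually_ne_nhds (fun hh => h1 (hh ▸ hx))
      filter_upwards [e0, e1, hc.continuousAt.eventually (eventually_lt_nhds hw2)] with y a b d
      exact ⟨hw1, fun _ => d, fun hh => by tauto⟩
    · refine ⟨0, ?_⟩
      filter_upwards [hM.isOpen_compl.mem_nhds hx] with y hy
      exact ⟨by simp, fun hh => absurd hh hy, fun _ => rfl⟩)
  exact ⟨g, (hg 0).2.2 (Or.inl rfl), (hg 1).2.2 (Or.inr rfl), fun t => (hg t).1,
    fun t ht => (hg t).2.1 ht⟩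

noncomputable def maxJ {E : Type*} [NormedAddCommGroup E] (J : E → ℝ)
    (γ : C(unitInterval, E)) : ℝ := sSup ((fun t => J (γ t)) '' Set.univ)

theorem maxJ_ge {E : Type*} [NormedAddCommGroup E] (J : E → ℝ) (hJ : Continuous J)
    (γ : C(unitInterval, E)) (t : unitInterval) : J (γ t) ≤ maxJ J γ :=
  le_csSup (isCompact_univ.image (by fun_prop)).bddAbove ⟨t, trivial, rfl⟩

theorem maxJ_attained {E : Type*} [NormedAddCommGroup E] (J : E → ℝ) (hJ : Continuous J)
    (γ : C(unitInterval, E)) : ∃ t, J (γ t) = maxJ J γ := by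
  obtain ⟨t, _, ht⟩ := (isCompact_univ.image (f := fun t => J (γ t)) (by fun_prop)).sSup_mem
    ⟨_, 0, trivial, rfl⟩
  exact ⟨t, ht⟩

theorem maxJ_continuous {E : Type*} [NormedAddCommGroup E] (J : E → ℝ) (hJ : Continuous J) :
    Continuous (maxJ J) := by
  refine IsCompact.continuous_sSup (f := fun (γ : C(unitInterval, E)) t => J (γ t))
    isCompact_univ ?_
  have : Continuous fun p : C(unitInterval, E) × unitInterval => J (p.1 p.2) := by fun_prop
  exact this

theorem point_aux {E : Type*} [NormedAddCommGroup E] [NormedSpace ℝ E]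
    (J : E → ℝ) (J' : E → E →L[ℝ] ℝ)
    (hJdiff : ∀ u, HasFDerivAt J (J' u) u) (hJ'cont : Continuous J')
    (γ : C(unitInterval, E)) (ε : ℝ) (hε : 0 < ε)
    (h0 : J (γ 0) < maxJ J γ) (h1 : J (γ 1) < maxJ J γ)
    (hmin : ∀ η : C(unitInterval, E), η 0 = γ 0 → η 1 = γ 1 →
      maxJ J γ ≤ maxJ J η + ε * dist γ η) :
    ∃ t, J (γ t) = maxJ J γ ∧ ‖J' (γ t)‖ ≤ ε := by
  have hJ : Continuous J := continuous_iff_continuousAt.2 fun u => (hJdiff u).continuousAt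
  by_contra hcon
  push Not at hcon
  obtain ⟨v, hv0, hv1, hv, hvM⟩ := field_aux J' hJ'cont γ {t | J (γ t) = maxJ J γ}
    (isClosed_eq (by fun_prop) continuous_const) h0.ne h1.ne ε hε hcon
  have key : ∀ n : ℕ, ∃ t : unitInterval, ∃ s ∈ Set.Ioo (0:ℝ) (1/((n:ℝ)+1)),
      -ε ≤ J' (γ t + s • v t) (v t) ∧
      maxJ J γ ≤ J (γ t + (1/((n:ℝ)+1)) • v t) + ε * (1/((n:ℝ)+1)) := by
    intro n
    have hh : (0:ℝ) < 1/((n:ℝ)+1) := by positivity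
    set h : ℝ := 1/((n:ℝ)+1)
    have hd : dist γ (γ + h • v) ≤ h := by
      rw [ContinuousMap.dist_le hh.le]
      intro t
      simp only [ContinuousMap.add_apply, ContinuousMap.smul_apply, dist_self_add_right, norm_smul,
        Real.norm_eq_abs, abs_of_pos hh]
      nlinarith [hv t]
    have hm := hmin (γ + h • v) (by simp [hv0]) (by simp [hv1])
    obtain ⟨t, ht⟩ := maxJ_attained J hJ (γ + h • v)
    simp only [ContinuousMap.add_apply, ContinuousMap.smul_apply] at ht
    have hm2 : maxJ J γ ≤ J (γ t + h • v t) + ε * h := by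
      rw [ht]
      nlinarith
    have hder : ∀ s : ℝ, HasDerivAt (fun s : ℝ => J (γ t + s • v t)) (J' (γ t + s • v t) (v t)) s := by
      intro s
      have hl : HasDerivAt (fun s : ℝ => γ t + s • v t) (v t) s := by
        simpa using ((hasDerivAt_id s).smul_const (v t)).const_add (γ t)
      exact (hJdiff _).comp_hasDerivAt s hl
    obtain ⟨s, hs, hslope⟩ := exists_hasDerivAt_eq_slope (fun s : ℝ => J (γ t + s • v t)) _ hh
      (fun s _ => (hder s).continuousAt.continuousWithinAt) (fun s _ => hder s)
    refine ⟨t, s, hs, ?_, hm2⟩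
    rw [hslope, le_div_iff₀ (by linarith)]
    have := maxJ_ge J hJ γ t
    simp only [zero_smul, add_zero, sub_zero]
    linarith
  choose t s hs hd hm using key
  obtain ⟨a, -, φ, hφ, hta⟩ := isCompact_univ.tendsto_subseq (x := t) (fun _ => trivial)
  have hh : Tendsto (fun n : ℕ => 1/((φ n:ℝ)+1)) atTop (𝓝 0) :=
    (tendsto_one_div_add_atTop_nhds_zero_nat (𝕜 := ℝ)).comp hφ.tendsto_atTop
  have hss : Tendsto (fun n : ℕ => s (φ n)) atTop (𝓝 0) :=
    squeeze_zero (fun n => (hs _).1.le) (fun n => (hs _).2.le) hh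
  have c1 : Continuous fun p : unitInterval × ℝ => J' (γ p.1 + p.2 • v p.1) (v p.1) := by
    fun_prop
  have c2 : Continuous fun p : unitInterval × ℝ => J (γ p.1 + p.2 • v p.1) + ε * p.2 := by
    fun_prop
  have l1 := ge_of_tendsto' ((c1.tendsto (a, 0)).comp (hta.prodMk_nhds hss)) (fun n => hd (φ n))
  have l2 := ge_of_tendsto' ((c2.tendsto (a, 0)).comp (hta.prodMk_nhds hh)) (fun n => hm (φ n))
  simp only [zero_smul, add_zero, mul_zero] at l1 l2
  exact absurd (hvM a (le_antisymm (maxJ_ge J hJ γ a) l2)) (not_lt.2 l1)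

/-- Mountain pass theorem (Palais–Smale sequence version): under the
mountain-pass geometry, the mountain-pass level `c` satisfies `c ≥ δ` and there is a
Palais–Smale sequence at level `c`. -/
theorem statement17 {E : Type*} [NormedAddCommGroup E] [NormedSpace ℝ E]
    [CompleteSpace E]
    (J : E → ℝ) (J' : E → E →L[ℝ] ℝ)
    (hJdiff : ∀ u, HasFDerivAt J (J' u) u) (hJ'cont : Continuous J')
    (hJ0 : J 0 = 0)
    (ρ δ : ℝ) (hρ : 0 < ρ) (hδ : 0 < δ)
    (hMP1 : ∀ u : E, ‖u‖ = ρ → δ ≤ J u)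
    (e : E) (he : ρ < ‖e‖) (hJe : J e < 0)
    (c : ℝ)
    (hc : c = sInf {m : ℝ | ∃ γ : ℝ → E, ContinuousOn γ (Set.Icc 0 1) ∧
      γ 0 = 0 ∧ γ 1 = e ∧ m = sSup ((fun σ => J (γ σ)) '' Set.Icc 0 1)}) :
    δ ≤ c ∧ ∃ u : ℕ → E, Tendsto (fun j => J (u j)) atTop (𝓝 c) ∧
      Tendsto (fun j => ‖J' (u j)‖) atTop (𝓝 0) := by
  have hJ : Continuous J := continuous_iff_continuousAt.2 fun u => (hJdiff u).continuousAt
  set A : Set ℝ := {m : ℝ | ∃ γ : ℝ → E, ContinuousOn γ (Set.Icc 0 1) ∧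
      γ 0 = 0 ∧ γ 1 = e ∧ m = sSup ((fun σ => J (γ σ)) '' Set.Icc 0 1)} with hA
  have hlow : ∀ m ∈ A, δ ≤ m := by
    rintro m ⟨γ, hγ, g0, g1, rfl⟩
    have hn : ContinuousOn (fun t => ‖γ t‖) (Set.Icc 0 1) := hγ.norm
    obtain ⟨t, ht, htρ⟩ := intermediate_value_Icc (zero_le_one' ℝ) hn
      (show ρ ∈ Set.Icc _ _ by simp only [g0, g1, norm_zero]; exact ⟨hρ.le, he.le⟩)
    exact (hMP1 _ htρ).trans (le_csSup
      (isCompact_Icc.image_of_continuousOn (hJ.comp_continuousOn hγ)).bddAbove ⟨t, ht, rfl⟩)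
  have hne : A.Nonempty := ⟨_, fun t => t • e, by fun_prop, by simp, by simp, rfl⟩
  have hbdd : BddBelow A := ⟨δ, hlow⟩
  have hδc : δ ≤ c := hc ▸ le_csInf hne hlow
  refine ⟨hδc, ?_⟩
  have hmem : ∀ γ : C(unitInterval, E), γ 0 = 0 → γ 1 = e → maxJ J γ ∈ A := by
    intro γ g0 g1
    refine ⟨Set.IccExtend zero_le_one γ, γ.continuous.Icc_extend'.continuousOn, ?_, ?_, ?_⟩
    · rw [Set.IccExtend_of_mem zero_le_one _ (by simp)]; exact g0
    · rw [Set.IccExtend_of_mem zero_le_one _ (by simp)]; exact g1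
    · unfold maxJ
      congr 1
      ext y
      constructor
      · rintro ⟨t, _, rfl⟩
        exact ⟨t, t.2, by simp [Set.IccExtend_of_mem zero_le_one γ t.2]⟩
      · rintro ⟨t, ht, rfl⟩
        exact ⟨⟨t, ht⟩, trivial, by simp [Set.IccExtend_of_mem zero_le_one γ ht]⟩
  have hex : ∀ m ∈ A, ∃ γ : C(unitInterval, E), γ 0 = 0 ∧ γ 1 = e ∧ maxJ J γ = m := by
    rintro m ⟨γ, hγ, g0, g1, rfl⟩
    refine ⟨⟨fun t => γ t, hγ.comp_continuous continuous_subtype_val fun t => t.2⟩, by simpa using g0,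
      by simpa using g1, ?_⟩
    unfold maxJ
    congr 1
    ext y
    constructor
    · rintro ⟨t, _, rfl⟩
      exact ⟨t, t.2, rfl⟩
    · rintro ⟨t, ht, rfl⟩
      exact ⟨⟨t, ht⟩, trivial, rfl⟩
  let X : Set C(unitInterval, E) := {γ | γ 0 = 0 ∧ γ 1 = e}
  have hXc : IsClosed X :=
    (isClosed_eq (by fun_prop) continuous_const).inter (isClosed_eq (by fun_prop) continuous_const)
  haveI : CompleteSpace X := hXc.completeSpace_coe
  have main : ∀ ε : ℝ, 0 < ε → ∃ u : E, c ≤ J u ∧ J u ≤ c + ε ∧ ‖J' u‖ ≤ ε := by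
    intro ε hε
    obtain ⟨m, hmA, hm⟩ := Real.lt_sInf_add_pos hne hε
    rw [← hc] at hm
    obtain ⟨γ₀, a0, a1, rfl⟩ := hex m hmA
    obtain ⟨⟨γ, g0, g1⟩, hγ, hmin⟩ := ekeland_aux (fun γ : X => maxJ J γ.1)
      ((maxJ_continuous J hJ).comp continuous_subtype_val) δ
      (fun γ => hlow _ (hmem γ.1 γ.2.1 γ.2.2)) ε hε ⟨γ₀, a0, a1⟩
    simp only at hγ
    have hγA := hmem γ g0 g1
    have hγδ := hlow _ hγA
    obtain ⟨t, ht, ht'⟩ := point_aux J J' hJdiff hJ'cont γ ε hε (by rw [g0, hJ0]; linarith)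
      (by rw [g1]; linarith)
      (fun η e0 e1 => hmin ⟨η, e0.trans g0, e1.trans g1⟩)
    refine ⟨γ t, ?_, ?_, ht'⟩
    · rw [ht, hc]; exact csInf_le hbdd hγA
    · rw [ht]; linarith
  choose u hu1 hu2 hu3 using fun n : ℕ => main (1/((n:ℝ)+1)) (by positivity)
  have hh := tendsto_one_div_add_atTop_nhds_zero_nat (𝕜 := ℝ)
  refine ⟨u, ?_, squeeze_zero (fun _ => norm_nonneg _) hu3 hh⟩
  exact tendsto_of_tendsto_of_tendsto_of_le_of_le tendsto_const_nhds
    (by simpa using hh.const_add c) hu1 hu2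
end

section
/- Let X be an infinite-dimensional real Banach space and J : X → ℝ a continuously Fréchet differentiable functional satisfying the Palais–Smale condition at every level c ∈ ℝ (every sequence {u_j} with J(u_j) → c and J′(u_j) → 0 in X* has a convergent subsequence), and suppose: (1) J(0) = 0 and there exist ρ > 0, δ > 0 with J(u) ≥ δ for all u ∈ X with ‖u‖ = ρ; (2) J is even, i.e. J(−u) = J(u) for all u; (3) for every finite-dimensional subspace Y ⊂ X there exists R = R(Y) > 0 such that J(u) ≤ 0 for all u ∈ Y with ‖u‖ ≥ R. Then J possesses an unbounded sequence of critical values: there exist points u_m ∈ X with J′(u_m) = 0 and J(u_m) → +∞. -/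
open Filter Topology

set_option linter.unusedSectionVars false

namespace SMP

/-! Combinatorial part -/
section comb
variable {V : Type*} [AddCommGroup V]

/-- coboundary on list cochains -/
def cob : (List V → ZMod 2) → List V → ZMod 2
  | _, [] => 0
  | F, x :: l => F l + cob (fun m => F (x :: m)) l

/-- dual prism -/
def pri (e : V) : (List V → ZMod 2) → List V → ZMod 2
  | _, [] => 0
  | F, x :: l => F (x :: (x + e) :: l.map (· + e)) + pri e (fun m => F (x :: m)) l

/-- prism simplices -/
def pris (e : V) : List V → List (List V)
  | [] => []
  | x :: l => (x :: (x + e) :: l.map (· + e)) :: (pris e l).map (x :: ·)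

def ev (F : List V → ZMod 2) (B : List (List V)) : ZMod 2 := (B.map F).sum

lemma ev_append (F : List V → ZMod 2) (B C : List (List V)) : ev F (B ++ C) = ev F B + ev F C := by
  simp [ev]

lemma ev_map (F : List V → ZMod 2) (f : List V → List V) (B : List (List V)) :
    ev F (B.map f) = ev (fun l => F (f l)) B := by
  simp [ev, Function.comp_def]

lemma ev_add (F G : List V → ZMod 2) (B : List (List V)) :
    ev (fun l => F l + G l) B = ev F B + ev G B := by
  simp [ev, List.sum_map_add]

lemma ev_congr {F G : List V → ZMod 2} {B : List (List V)} (h : ∀ l ∈ B, F l = G l) :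
    ev F B = ev G B := by
  unfold ev; rw [List.map_congr_left h]

lemma ev_zero {F : List V → ZMod 2} {B : List (List V)} (h : ∀ l ∈ B, F l = 0) :
    ev F B = 0 := by
  rw [ev_congr h]; simp [ev]

lemma ev_flatMap (F : List V → ZMod 2) {ι : Type*} (f : ι → List (List V)) (B : List ι) :
    ev F (B.flatMap f) = (B.map (fun i => ev F (f i))).sum := by
  induction B with
  | nil => simp [ev]
  | cons a B ih => simp [ev_append, ih]

lemma ev_pris (e : V) (l : List V) : ∀ F, ev F (pris e l) = pri e F l := by
  induction l with
  | nil => intro F; simp [pris, pri, ev]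
  | cons x l ih =>
    intro F
    have := ih (fun m => F (x :: m))
    simp only [pris, pri, ← this]
    simp [ev, Function.comp_def]

lemma cob_add (l : List V) : ∀ F G : List V → ZMod 2,
    cob (fun m => F m + G m) l = cob F l + cob G l := by
  induction l with
  | nil => intro F G; simp [cob]
  | cons x l ih => intro F G; simp only [cob, ih]; ring

lemma pri_add (e : V) (l : List V) : ∀ F G : List V → ZMod 2,
    pri e (fun m => F m + G m) l = pri e F l + pri e G l := by
  induction l with
  | nil => intro F G; simp [pri]
  | cons x l ih => intro F G; simp only [pri, ih]; ring

lemma cob_map (f : V → V) (l : List V) : ∀ F : List V → ZMod 2,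
    cob (fun m => F (m.map f)) l = cob F (l.map f) := by
  induction l with
  | nil => intro F; simp [cob]
  | cons x l ih =>
    intro F
    simp only [cob, List.map_cons]
    rw [ih (fun m => F (f x :: m))]

lemma two_eq (a : ZMod 2) : a + a = 0 := CharTwo.add_self_eq_zero a

lemma homotopy (e : V) (l : List V) : ∀ F : List V → ZMod 2,
    pri e (cob F) l = cob (pri e F) l + F (l.map (· + e)) + F l := by
  induction l with
  | nil => intro F; simp [pri, cob, two_eq]
  | cons x l ih =>
    intro F
    have h1 : pri e (fun m => cob F (x :: m)) l
        = pri e F l + pri e (cob (fun m => F (x :: m))) l := by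
      rw [← pri_add]; rfl
    have h2 : cob (fun m => pri e F (x :: m)) l
        = cob (fun m => F (x :: (x + e) :: m)) (l.map (· + e))
          + cob (pri e (fun m => F (x :: m))) l := by
      rw [← cob_map, ← cob_add]; rfl
    simp only [pri, cob, List.map_cons] at *
    rw [h1, h2, ih]
    have := two_eq (F (x :: l.map (· + e)))
    linear_combination this

lemma cob_sum {ι : Type*} (B : List ι) (F : ι → List V → ZMod 2) (l : List V) :
    cob (fun m => (B.map (fun i => F i m)).sum) l = (B.map (fun i => cob (F i) l)).sum := by
  induction B with
  | nil =>
    simp only [List.map_nil, List.sum_nil]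
    induction l with
    | nil => rfl
    | cons x l ih => simp [cob, ih]
  | cons a B ih => simp only [List.map_cons, List.sum_cons, cob_add, ih]

lemma ev_sum {ι : Type*} (C : List ι) (F : ι → List V → ZMod 2) (B : List (List V)) :
    ev (fun m => (C.map (fun i => F i m)).sum) B = (C.map (fun i => ev (F i) B)).sum := by
  induction C with
  | nil => simp [ev]
  | cons a C ih => simp only [List.map_cons, List.sum_cons, ev_add, ih]

/-- Products -/
def Q : (ℕ → V → ZMod 2) → List V → ZMod 2
  | _, [] => 0
  | t, [x] => t 0 x
  | t, x :: y :: l => (t 0 x + t 0 y) * Q (fun i => t (i + 1)) (y :: l)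

def W : (ℕ → V → ZMod 2) → List V → ZMod 2
  | _, [] => 0
  | _, [_] => 1
  | t, x :: y :: l => (t 0 x + t 0 y) * W (fun i => t (i + 1)) (y :: l)

lemma cob_mul (c : ZMod 2) (l : List V) : ∀ F : List V → ZMod 2,
    cob (fun m => c * F m) l = c * cob F l := by
  induction l with
  | nil => intro F; simp [cob]
  | cons x l ih => intro F; simp only [cob, ih]; ring

/-- `G(x,·)` where the head of tail decides. -/
lemma cob_Q (l : List V) : ∀ (t : ℕ → V → ZMod 2) (x y : V),
    cob (Q t) (x :: y :: l) = W t (x :: y :: l) := by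
  induction l with
  | nil => intro t x y; simp [cob, Q, W]; ring
  | cons z l ih =>
    intro t x y
    have h := ih (fun i => t (i + 1)) y z
    -- cob (Q t) (y :: z :: l)
    have key : ∀ l' : List V, ∀ c : ZMod 2, cob (fun m => Q t (x :: y :: m)) l'
        = (t 0 x + t 0 y) * cob (fun m => Q (fun i => t (i + 1)) (y :: m)) l' := by
      intro l' c; rw [← cob_mul]; rfl
    have e1 : cob (Q t) (x :: y :: z :: l) = Q t (y :: z :: l) + Q t (x :: z :: l)
        + (t 0 x + t 0 y) * cob (fun m => Q (fun i => t (i + 1)) (y :: m)) (z :: l) := by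
      rw [← key _ 0]; simp only [cob]; ring
    have e2 : cob (Q (fun i => t (i + 1))) (y :: z :: l) = Q (fun i => t (i + 1)) (z :: l)
        + cob (fun m => Q (fun i => t (i + 1)) (y :: m)) (z :: l) := rfl
    have e3 : cob (fun m => Q (fun i => t (i + 1)) (y :: m)) (z :: l)
        = W (fun i => t (i + 1)) (y :: z :: l) + Q (fun i => t (i + 1)) (z :: l) := by
      rw [← h, e2]; linear_combination - two_eq (Q (fun i => t (i + 1)) (z :: l))
    rw [e1, e3]
    simp only [Q, W]
    linear_combination (t 0 z * Q (fun i => t (i + 1)) (z :: l) + t 0 x * Q (fun i => t (i + 1)) (z :: l) + t 0 y * Q (fun i => t (i + 1)) (z :: l)) * (two_eq 1)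

end comb

section grid

abbrev Gr := ℕ → ℤ

def ek (k : ℕ) : Gr := Pi.single k 1

def BB (N k : ℕ) (C : List (List Gr)) : List (List Gr) :=
  C.flatMap fun l => (List.range N).flatMap fun j => pris (ek k) (l.map (· + j • ek k))

def T (N : ℕ) : ℕ → List (List Gr)
  | 0 => [[0]]
  | k + 1 => BB N k (T N k) ++ (BB N k (T N k)).map (List.map (fun x => -x))

def far (N k : ℕ) (l : List Gr) : Prop := l = [] ∨ ∃ i < k, ∀ x ∈ l, (N : ℤ) ≤ |x i|

def supp (k n : ℕ) (l : List Gr) : Prop :=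
  l.length = n ∧ (∀ x ∈ l, ∀ i, k ≤ i → x i = 0) ∧ ∀ x ∈ l, ∀ y ∈ l, ∀ i, |x i - y i| ≤ 1

lemma length_pris {V : Type*} [AddCommGroup V] (e : V) (l : List V) :
    ∀ l' ∈ pris e l, l'.length = l.length + 1 := by
  induction l with
  | nil => simp [pris]
  | cons x l ih =>
    intro l' h
    simp only [pris, List.mem_cons, List.mem_map] at h
    rcases h with rfl | ⟨m, hm, rfl⟩
    · simp
    · simp [ih m hm]

lemma mem_pris {V : Type*} [AddCommGroup V] (e : V) (l : List V) :
    ∀ l' ∈ pris e l, ∀ y ∈ l', ∃ x ∈ l, y = x ∨ y = x + e := by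
  induction l with
  | nil => simp [pris]
  | cons x l ih =>
    intro l' h y hy
    simp only [pris, List.mem_cons, List.mem_map] at h
    rcases h with rfl | ⟨m, hm, rfl⟩
    · simp only [List.mem_cons, List.mem_map] at hy
      rcases hy with rfl | rfl | ⟨z, hz, rfl⟩
      · exact ⟨y, by simp, Or.inl rfl⟩
      · exact ⟨x, by simp, Or.inr rfl⟩
      · exact ⟨z, by simp [hz], Or.inr rfl⟩
    · simp only [List.mem_cons] at hy
      rcases hy with rfl | hy
      · exact ⟨y, by simp, Or.inl rfl⟩
      · obtain ⟨z, hz, h⟩ := ih m hm y hy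
        exact ⟨z, by simp [hz], h⟩

lemma supp_BB {N k : ℕ} {C : List (List Gr)} (hC : ∀ l ∈ C, supp k (k + 1) l) :
    ∀ l ∈ BB N k C, supp (k + 1) (k + 2) l := by
  intro l hl
  simp only [BB, List.mem_flatMap] at hl
  obtain ⟨m, hm, j, hj, hl⟩ := hl
  obtain ⟨h1, h2, h3⟩ := hC m hm
  have key : ∀ y ∈ l, ∃ x ∈ m, ∃ b : ℤ, (b = 0 ∨ b = 1) ∧
      ∀ i, y i = x i + if i = k then (j + b : ℤ) else 0 := by
    intro y hy
    obtain ⟨z, hz, h⟩ := mem_pris _ _ l hl y hy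
    simp only [List.mem_map] at hz
    obtain ⟨x, hx, rfl⟩ := hz
    rcases h with rfl | rfl
    · refine ⟨x, hx, 0, Or.inl rfl, fun i => ?_⟩
      by_cases h : i = k
      · subst h; simp [ek]
      · simp [ek, h]
    · refine ⟨x, hx, 1, Or.inr rfl, fun i => ?_⟩
      by_cases h : i = k
      · subst h; simp [ek, add_assoc]
      · simp [ek, h]
  refine ⟨by rw [length_pris _ _ l hl]; simp [h1], ?_, ?_⟩
  · intro y hy i hi
    obtain ⟨x, hx, b, hb, h⟩ := key y hy
    rw [h i, h2 x hx i (by omega), if_neg (by omega)]; simp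
  · intro y hy y' hy' i
    obtain ⟨x, hx, b, hb, h⟩ := key y hy
    obtain ⟨x', hx', b', hb', h'⟩ := key y' hy'
    rw [h i, h' i]
    by_cases hi : i = k
    · subst hi
      rw [h2 x hx _ le_rfl, h2 x' hx' _ le_rfl]
      rcases hb with rfl | rfl <;> rcases hb' with rfl | rfl <;> simp
    · simpa [hi] using h3 x hx x' hx' i

lemma supp_neg {k n : ℕ} {l : List Gr} (h : supp k n l) : supp k n (l.map (fun x => -x)) := by
  obtain ⟨h1, h2, h3⟩ := h
  refine ⟨by simpa using h1, ?_, ?_⟩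
  · intro x hx i hi
    simp only [List.mem_map] at hx
    obtain ⟨y, hy, rfl⟩ := hx
    simp [h2 y hy i hi]
  · intro x hx x' hx' i
    simp only [List.mem_map] at hx hx'
    obtain ⟨y, hy, rfl⟩ := hx
    obtain ⟨y', hy', rfl⟩ := hx'
    have := h3 y' hy' y hy i
    simp only [Pi.neg_apply]
    convert this using 2
    ring

lemma supp_T (N k : ℕ) : ∀ l ∈ T N k, supp k (k + 1) l := by
  induction k with
  | zero => intro l hl; simp [T] at hl; subst hl; simp [supp]
  | succ k ih =>
    intro l hl
    simp only [T, List.mem_append, List.mem_map] at hl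
    rcases hl with h | ⟨m, hm, rfl⟩
    · exact supp_BB ih l h
    · exact supp_neg (supp_BB ih m hm)

lemma ev_T_neg (N k : ℕ) (F : List Gr → ZMod 2) :
    ev (fun l => F (l.map (fun x => -x))) (T N k) = ev F (T N k) := by
  cases k with
  | zero => simp [T, ev]
  | succ k =>
    simp only [T, ev_append, ev_map]
    rw [add_comm]
    congr 1
    simp

lemma far_neg {N k : ℕ} {l : List Gr} (h : far N k l) : far N k (l.map (fun x => -x)) := by
  rcases h with rfl | ⟨i, hi, h⟩
  · left; simp
  · right
    refine ⟨i, hi, ?_⟩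
    intro x hx
    simp only [List.mem_map] at hx
    obtain ⟨y, hy, rfl⟩ := hx
    simpa using h y hy

lemma telescope (e : Gr) (N : ℕ) (F : List Gr → ZMod 2) (l : List Gr) :
    ((List.range N).map (fun j => F ((l.map (· + j • e)).map (· + e)) + F (l.map (· + j • e)))).sum
      = F (l.map (· + N • e)) + F l := by
  induction N with
  | zero => simp [two_eq]
  | succ n ih =>
    rw [List.range_succ, List.map_append, List.sum_append, ih]
    simp only [List.map_cons, List.map_nil, List.sum_cons, List.sum_nil]
    have : (l.map (· + n • e)).map (· + e) = l.map (· + (n + 1) • e) := by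
      simp [Function.comp_def, add_smul, add_assoc]
    rw [this]
    linear_combination two_eq (F (l.map (· + n • e)))

lemma bdry_aux (N k : ℕ)
    (cyc : ∀ F : List Gr → ZMod 2, (∀ l, far N k l → F l = 0) → ev (cob F) (T N k) = 0)
    (F : List Gr → ZMod 2) (hF : ∀ l, far N (k + 1) l → F l = 0) :
    ev (cob F) (BB N k (T N k)) = ev F (T N k) := by
  let G : List Gr → ZMod 2 := fun m =>
    ((List.range N).map (fun j => pri (ek k) F (m.map (· + j • ek k)))).sum
  have h1 : ev (cob F) (BB N k (T N k)) =
      ev (fun l => cob G l + (F (l.map (· + N • ek k)) + F l)) (T N k) := by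
    rw [BB, ev_flatMap]
    unfold ev
    congr 1
    apply List.map_congr_left
    intro l hl
    change ev (cob F) _ = _
    rw [ev_flatMap, ← telescope]
    simp only [G]
    rw [cob_sum, ← List.sum_map_add]
    congr 1
    apply List.map_congr_left
    intro j hj
    rw [ev_pris, homotopy, add_assoc, ← cob_map]
  have hG : ∀ l, far N k l → G l = 0 := by
    intro l hl
    simp only [G]
    apply List.sum_eq_zero
    intro z hz
    simp only [List.mem_map] at hz
    obtain ⟨j, hj, rfl⟩ := hz
    rw [← ev_pris]
    apply ev_zero
    intro l' hl'
    apply hF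
    rcases hl with rfl | ⟨i, hi, h⟩
    · simp [pris] at hl'
    · right
      refine ⟨i, by omega, fun y hy => ?_⟩
      obtain ⟨z, hz, h'⟩ := mem_pris _ _ l' hl' y hy
      simp only [List.mem_map] at hz
      obtain ⟨x, hx, rfl⟩ := hz
      have hik : i ≠ k := by omega
      have : y i = x i := by
        rcases h' with rfl | rfl <;> simp [ek, hik]
      rw [this]; exact h x hx
  have hz : ev (fun l => F (l.map (· + N • ek k))) (T N k) = 0 := by
    apply ev_zero
    intro l hl
    apply hF
    right
    refine ⟨k, by omega, fun y hy => ?_⟩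
    simp only [List.mem_map] at hy
    obtain ⟨x, hx, rfl⟩ := hy
    have := (supp_T N k l hl).2.1 x hx k le_rfl
    simp [this, ek]
  rw [h1, ev_add, ev_add, cyc G hG, hz]; simp

lemma cyc (N k : ℕ) : ∀ F : List Gr → ZMod 2, (∀ l, far N k l → F l = 0) →
    ev (cob F) (T N k) = 0 := by
  induction k with
  | zero =>
    intro F hF
    simp [T, ev, cob, hF [] (Or.inl rfl)]
  | succ k ih =>
    intro F hF
    simp only [T, ev_append, ev_map]
    rw [bdry_aux N k ih F hF]
    have : (fun l : List Gr => cob F (l.map (fun x => -x)))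
        = cob (fun l => F (l.map (fun x => -x))) := by
      funext l; rw [cob_map (fun x => -x) l F]
    rw [this, bdry_aux N k ih _ (fun l hl => hF _ (far_neg hl)), ev_T_neg, two_eq]

lemma bdry (N k : ℕ) (F : List Gr → ZMod 2) (hF : ∀ l, far N (k + 1) l → F l = 0) :
    ev (cob F) (BB N k (T N k)) = ev F (T N k) := bdry_aux N k (cyc N k) F hF

/-- last-factor symmetrisation -/
lemma Q_neg_aux (l : List Gr) : ∀ (t : ℕ → Gr → ZMod 2) (x : Gr),
    (∀ i, ∀ y ∈ x :: l, t i y + t i (-y) = 1) →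
    Q t (x :: l) + Q t ((x :: l).map (fun x => -x)) = W t (x :: l) := by
  induction l with
  | nil => intro t x h; simpa [Q, W] using h 0 x (by simp)
  | cons y l ih =>
    intro t x h
    have h1 := ih (fun i => t (i + 1)) y (fun i z hz => h (i + 1) z (by simp [hz]))
    have hx := h 0 x (by simp)
    have hy := h 0 y (by simp)
    simp only [Q, W, List.map_cons] at *
    rw [← h1]
    have e : t 0 (-x) + t 0 (-y) = t 0 x + t 0 y := by
      linear_combination hx + hy - two_eq (t 0 x) - two_eq (t 0 y) + two_eq 1
    rw [e]; ring

/-- Combinatorial Borsuk–Ulam -/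
lemma combBU (N m : ℕ) (hm : 0 < m) (t : ℕ → Gr → ZMod 2)
    (h0 : ∀ x : Gr, (∀ i, |x i| ≤ 1) → t 0 x = 1)
    (hev : ∀ x, t 0 (-x) = t 0 x)
    (hodd : ∀ i x, x ≠ 0 → t (i + 1) x + t (i + 1) (-x) = 1)
    (hfar : ∀ x : Gr, ∀ i < m, (N : ℤ) ≤ |x i| → t 0 x = 0) :
    ∃ l, supp m (m + 1) l ∧ W t l ≠ 0 := by
  have hQ : ∀ k < m, ∀ l, far N (k + 1) l → Q t l = 0 := by
    intro k hk l hl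
    rcases hl with rfl | ⟨i, hi, h⟩
    · rfl
    · match l with
      | [] => rfl
      | [x] => exact hfar x i (by omega) (h x (by simp))
      | x :: y :: l =>
        simp only [Q]
        rw [hfar x i (by omega) (h x (by simp)), hfar y i (by omega) (h y (by simp))]; simp
  have step1 : ∀ k < m, ev (W t) (BB N k (T N k)) = ev (Q t) (T N k) := by
    intro k hk
    rw [← bdry N k (Q t) (hQ k hk)]
    apply ev_congr
    intro l hl
    have := (supp_BB (supp_T N k) l hl).1
    match l, this with
    | x :: y :: l, _ => rw [cob_Q]
  have step2 : ∀ k < m, ev (W t) (BB N k (T N k)) = 1 := by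
    intro k
    induction k with
    | zero =>
      intro hk
      rw [step1 0 hk]
      simp [T, ev, Q, h0 0]
    | succ k ih =>
      intro hk
      rw [step1 (k + 1) hk, ← ih (by omega)]
      simp only [T, ev_append, ev_map]
      rw [← ev_add]
      apply ev_congr
      intro l hl
      obtain ⟨hlen, -, hsm⟩ := supp_BB (supp_T N k) l hl
      match l, hlen with
      | x :: y :: l, _ =>
        simp only [Q, W, List.map_cons, hev]
        by_cases hz : (0 : Gr) ∈ x :: y :: l
        · have hx : t 0 x = 1 := h0 x fun i => by simpa using hsm x (by simp) 0 hz i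
          have hy : t 0 y = 1 := h0 y fun i => by simpa using hsm y (by simp) 0 hz i
          rw [hx, hy, two_eq]; simp
        · rw [← Q_neg_aux l _ y (fun i z hz' => hodd i z ?_)]
          · simp only [List.map_cons]; ring
          · rintro rfl; exact hz (List.mem_cons_of_mem _ hz')
  obtain ⟨k, rfl⟩ : ∃ k, m = k + 1 := ⟨m - 1, by omega⟩
  by_contra hcon
  push Not at hcon
  have h := step2 k (by omega)
  rw [ev_zero (fun l hl => hcon l (supp_BB (supp_T N k) l hl))] at h
  exact zero_ne_one h

end grid

end SMP
namespace SMP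
section topo

lemma W_ne {V : Type*} [AddCommGroup V] (l : List V) : ∀ (t : ℕ → V → ZMod 2), W t l ≠ 0 →
    ∀ i, i + 1 < l.length → ∃ x ∈ l, ∃ y ∈ l, t i x + t i y ≠ 0 := by
  induction l with
  | nil => intro t h; exact absurd rfl h
  | cons x l ih =>
    intro t h i hi
    match l, ih, h, hi with
    | [], _, _, hi => simp at hi
    | y :: l, ih, h, hi =>
      simp only [W] at h
      have h1 := left_ne_zero_of_mul h
      have h2 := right_ne_zero_of_mul h
      cases i with
      | zero => exact ⟨x, by simp, y, by simp, h1⟩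
      | succ i =>
        obtain ⟨a, ha, b, hb, hab⟩ := ih _ h2 i (by simp at hi ⊢; omega)
        exact ⟨a, by simp [ha], b, by simp [hb], hab⟩

lemma exists_antipodal : ∃ a : Gr → ZMod 2, ∀ x, x ≠ 0 → a x + a (-x) = 1 := by
  classical
  refine ⟨fun x => if 0 < x (sInf {i | x i ≠ 0}) then 1 else 0, fun x hx => ?_⟩
  have hne : ({i | x i ≠ 0} : Set ℕ).Nonempty := by
    by_contra h
    rw [Set.not_nonempty_iff_eq_empty] at h
    apply hx
    funext i
    by_contra hi
    have : i ∈ ({i | x i ≠ 0} : Set ℕ) := hi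
    rw [h] at this; exact this
  have h1 : x (sInf {i | x i ≠ 0}) ≠ 0 := Nat.sInf_mem hne
  have h2 : ({i | (-x) i ≠ 0} : Set ℕ) = {i | x i ≠ 0} := by ext i; simp
  change (if 0 < x (sInf {i | x i ≠ 0}) then (1 : ZMod 2) else 0)
    + (if 0 < (-x) (sInf {i | (-x) i ≠ 0}) then 1 else 0) = 1
  rw [h2, Pi.neg_apply]
  rcases lt_or_gt_of_ne h1 with h | h
  · rw [if_neg (by omega), if_pos (by omega)]; simp
  · rw [if_pos (by omega), if_neg (by omega)]; simp

lemma coordBU (n : ℕ) (g : (Fin (n + 1) → ℝ) → ℝ) (hg : Continuous g) (hge : ∀ x, g (-x) = g x)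
    (ρ R : ℝ) (hg0 : g 0 < ρ) (hR : ∀ x, R ≤ ‖x‖ → ρ ≤ g x)
    (U : Fin n → Set (Fin (n + 1) → ℝ)) (hU : ∀ i, IsOpen (U i)) (hUd : ∀ i, ∀ x ∈ U i, -x ∉ U i)
    (hc : ∀ x, ‖x‖ ≤ R + 1 → g x = ρ → ∃ i, x ∈ U i ∨ -x ∈ U i) : False := by
  classical
  -- Lebesgue number
  have hZ : IsCompact {x : Fin (n + 1) → ℝ | ‖x‖ ≤ R + 1 ∧ g x = ρ} := by
    have : {x : Fin (n + 1) → ℝ | ‖x‖ ≤ R + 1 ∧ g x = ρ} = Metric.closedBall 0 (R + 1) ∩ {x | g x = ρ} := by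
      ext x; simp
    rw [this]
    exact (isCompact_closedBall _ _).inter_right (isClosed_eq hg continuous_const)
  obtain ⟨ε, hε, hleb⟩ : ∃ ε > 0, ∀ x ∈ {x : Fin (n + 1) → ℝ | ‖x‖ ≤ R + 1 ∧ g x = ρ}, ∃ i : Fin n ⊕ Fin n,
      Metric.ball x ε ⊆ Sum.elim U (fun i => {x | -x ∈ U i}) i := by
    apply lebesgue_number_lemma_of_metric hZ
    · rintro (i | i)
      · exact hU i
      · exact (hU i).preimage continuous_neg
    · rintro x ⟨hx, hx'⟩
      obtain ⟨i, hi | hi⟩ := hc x hx hx'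
      · exact Set.mem_iUnion.2 ⟨Sum.inl i, hi⟩
      · exact Set.mem_iUnion.2 ⟨Sum.inr i, hi⟩
  obtain ⟨ε₀, hε₀, hball⟩ : ∃ ε₀ > 0, ∀ x : Fin (n + 1) → ℝ, ‖x‖ < ε₀ → g x < ρ := by
    have := Metric.eventually_nhds_iff.1 (hg.continuousAt.eventually (gt_mem_nhds hg0))
    obtain ⟨e, he, h⟩ := this
    exact ⟨e, he, fun x hx => h (by simpa using hx)⟩
  obtain ⟨s, hs, hs1⟩ : ∃ s : ℝ, 0 < s ∧ s < min ε (min ε₀ 1) :=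
    exists_between (by positivity)
  have hsε : s < ε := lt_of_lt_of_le hs1 (min_le_left _ _)
  have hsε₀ : s < ε₀ := lt_of_lt_of_le hs1 ((min_le_right _ _).trans (min_le_left _ _))
  have hs1' : s < 1 := lt_of_lt_of_le hs1 ((min_le_right _ _).trans (min_le_right _ _))
  obtain ⟨N, hN⟩ := exists_nat_ge (R / s)
  let p : Gr → Fin (n + 1) → ℝ := fun x i => s * (x i : ℝ)
  have hpneg : ∀ x, p (-x) = - p x := by intro x; funext i; simp [p]
  have hpd : ∀ x y : Gr, (∀ i, |x i - y i| ≤ 1) → dist (p x) (p y) ≤ s := by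
    intro x y h
    rw [dist_pi_le_iff hs.le]
    intro i
    have h2 : |((x i : ℝ) - y i)| ≤ 1 := by exact_mod_cast h i
    rw [Real.dist_eq]
    simp only [p]
    rw [← mul_sub, abs_mul, abs_of_pos hs]
    nlinarith
  obtain ⟨a, ha⟩ := exists_antipodal
  let t : ℕ → Gr → ZMod 2 := fun i x =>
    match i with
    | 0 => if g (p x) < ρ then 1 else 0
    | i + 1 => if h : i < n then (if p x ∈ U ⟨i, h⟩ then 1 else if - p x ∈ U ⟨i, h⟩ then 0 else a x)
        else a x
  obtain ⟨l, ⟨hlen, -, hsm⟩, hW⟩ := combBU N (n + 1) (by omega) t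
    (by
      intro x hx
      have : dist (p x) (p 0) ≤ s := hpd x 0 (by simpa using hx)
      have h0 : p 0 = 0 := by funext i; simp [p]
      rw [h0, dist_zero_right] at this
      simp only [t]
      rw [if_pos (hball _ (by linarith))])
    (by intro x; simp only [t, hpneg, hge])
    (by
      intro i x hx
      simp only [t, hpneg, neg_neg]
      by_cases h : i < n
      · simp only [h, dif_pos]
        by_cases h1 : p x ∈ U ⟨i, h⟩
        · have h2 := hUd _ _ h1
          simp [h1, h2]
        · by_cases h2 : -p x ∈ U ⟨i, h⟩
          · simp [h1, h2]
          · simp [h1, h2, ha x hx]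
      · simp [h, ha x hx])
    (by
      intro x i hi hx
      simp only [t]
      rw [if_neg]
      push Not
      apply hR
      have h1 : |p x ⟨i, hi⟩| ≤ ‖p x‖ := norm_le_pi_norm (p x) ⟨i, hi⟩
      have h2 : (N : ℝ) ≤ |(x i : ℝ)| := by exact_mod_cast hx
      have h3 : |p x ⟨i, hi⟩| = s * |(x i : ℝ)| := by simp only [p]; rw [abs_mul, abs_of_pos hs]
      rw [div_le_iff₀ hs] at hN
      nlinarith)
  have hWn := W_ne l t hW
  obtain ⟨x, hx, y, hy, hxy⟩ := hWn 0 (by omega)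
  -- a point on the level set
  obtain ⟨z, hz, hzρ⟩ : ∃ z : Fin (n + 1) → ℝ, (∀ w ∈ l, dist z (p w) ≤ s) ∧ g z = ρ ∧ ‖z‖ ≤ R + 1 := by
    have main : ∀ x ∈ l, ∀ y ∈ l, g (p x) < ρ → ρ ≤ g (p y) →
        ∃ z : Fin (n + 1) → ℝ, (∀ w ∈ l, dist z (p w) ≤ s) ∧ g z = ρ ∧ ‖z‖ ≤ R + 1 := by
      intro x hx y hy h1 h2
      have hpre : IsPreconnected (segment ℝ (p x) (p y)) := (convex_segment _ _).isPreconnected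
      obtain ⟨z, hz, hgz⟩ := hpre.intermediate_value (left_mem_segment ℝ _ _)
        (right_mem_segment ℝ _ _) hg.continuousOn ⟨h1.le, h2⟩
      have hd : ∀ w ∈ l, dist z (p w) ≤ s := by
        intro w hw
        have := (convex_closedBall (p w) s).segment_subset
          (Metric.mem_closedBall.2 (hpd x w (hsm x hx w hw)))
          (Metric.mem_closedBall.2 (hpd y w (hsm y hy w hw))) hz
        exact Metric.mem_closedBall.1 this
      refine ⟨z, hd, hgz, ?_⟩
      have h3 : ‖p x‖ < R := by
        by_contra h; push Not at h; linarith [hR _ h]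
      have h4 := hd x hx
      have h5 : ‖z‖ ≤ ‖z - p x‖ + ‖p x‖ := by simpa using norm_add_le (z - p x) (p x)
      rw [dist_eq_norm] at h4
      linarith
    by_cases h1 : g (p x) < ρ <;> by_cases h2 : g (p y) < ρ
    · exfalso; apply hxy; simp only [t, h1, h2, if_true]; exact two_eq 1
    · exact main x hx y hy h1 (not_lt.1 h2)
    · exact main y hy x hx h2 (not_lt.1 h1)
    · exfalso; apply hxy; simp [t, h1, h2]
  have hin : ∀ w ∈ l, p w ∈ Metric.ball z ε := fun w hw => by
    rw [Metric.mem_ball, dist_comm]; exact lt_of_le_of_lt (hz w hw) hsε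
  obtain ⟨i | i, hi⟩ := hleb z ⟨hzρ.2, hzρ.1⟩
  · obtain ⟨x, hx, y, hy, hxy⟩ := hWn (i + 1) (by have := i.2; omega)
    have h1 : p x ∈ U i := hi (hin x hx)
    have h2 : p y ∈ U i := hi (hin y hy)
    apply hxy
    simp [t, h1, h2, two_eq]
  · obtain ⟨x, hx, y, hy, hxy⟩ := hWn (i + 1) (by have := i.2; omega)
    have h1 : - p x ∈ U i := hi (hin x hx)
    have h2 : - p y ∈ U i := hi (hin y hy)
    have h1' : p x ∉ U i := by simpa using hUd i _ h1
    have h2' : p y ∉ U i := by simpa using hUd i _ h2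
    apply hxy
    simp [t, h1, h2, h1', h2']

end topo
end SMP
namespace SMP
section vari
open TopologicalSpace

/-- Ekeland's variational principle -/
lemma ekeland {Y : Type*} [MetricSpace Y] [CompleteSpace Y] (Φ : Y → ℝ)
    (hΦ : LowerSemicontinuous Φ) (b : ℝ) (hb : ∀ y, b ≤ Φ y) (σ : ℝ) (hσ : 0 < σ) (x₀ : Y) :
    ∃ y, Φ y + σ * dist x₀ y ≤ Φ x₀ ∧ ∀ z, z ≠ y → Φ y < Φ z + σ * dist y z := by
  let S : Y → Set Y := fun x => {z | Φ z + σ * dist x z ≤ Φ x}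
  have hself : ∀ x, x ∈ S x := fun x => by simp [S]
  have htrans : ∀ x y z, y ∈ S x → z ∈ S y → z ∈ S x := by
    intro x y z h1 h2
    simp only [S, Set.mem_ofPred_eq] at *
    nlinarith [dist_triangle x y z]
  have hclosed : ∀ x, IsClosed (S x) := by
    intro x
    have : LowerSemicontinuous (fun z => Φ z + σ * dist x z) :=
      hΦ.add (Continuous.lowerSemicontinuous (by fun_prop))
    exact this.isClosed_preimage (Φ x)
  have hstep : ∀ (k : ℕ) (x : Y), ∃ y ∈ S x, ∀ z ∈ S x, Φ y ≤ Φ z + (1 / 2) ^ k := by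
    intro k x
    have hne : (Φ '' S x).Nonempty := ⟨_, x, hself x, rfl⟩
    have hbd : BddBelow (Φ '' S x) := ⟨b, by rintro _ ⟨y, _, rfl⟩; exact hb y⟩
    obtain ⟨_, ⟨y, hy, rfl⟩, h⟩ := exists_lt_of_csInf_lt hne
      (show sInf (Φ '' S x) < sInf (Φ '' S x) + (1 / 2) ^ k by
        have : (0 : ℝ) < (1 / 2) ^ k := by positivity
        linarith)
    refine ⟨y, hy, fun z hz => ?_⟩
    have := csInf_le hbd ⟨z, hz, rfl⟩
    linarith
  choose f hfS hf using hstep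
  let x : ℕ → Y := fun n => Nat.rec x₀ (fun k y => f k y) n
  have hx : ∀ k, x (k + 1) = f k (x k) := fun k => rfl
  have hsucc : ∀ k, x (k + 1) ∈ S (x k) := fun k => by rw [hx]; exact hfS _ _
  have hclose : ∀ k, ∀ z ∈ S (x (k + 1)), dist (x (k + 1)) z ≤ (1 / σ) * (1 / 2) ^ k := by
    intro k z hz
    have h1 := hf k (x k) z (htrans _ _ _ (hsucc k) hz)
    rw [← hx] at h1
    have h2 : Φ z + σ * dist (x (k + 1)) z ≤ Φ (x (k + 1)) := hz
    rw [one_div, inv_mul_eq_div, le_div_iff₀ hσ]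
    linarith
  have hmono : ∀ j k, j ≤ k → x k ∈ S (x j) := by
    intro j k h
    induction h with
    | refl => exact hself _
    | step _ ih => exact htrans _ _ _ ih (hsucc _)
  have hcau : CauchySeq (fun k => x (k + 1)) := by
    apply cauchySeq_of_le_geometric (1 / 2) (1 / σ) (by norm_num)
    intro k
    exact hclose k _ (hsucc (k + 1))
  obtain ⟨y, hy⟩ := cauchySeq_tendsto_of_complete hcau
  have hyS : ∀ k, y ∈ S (x k) := by
    intro k
    apply (hclosed (x k)).mem_of_tendsto hy
    filter_upwards [eventually_ge_atTop k] with j hj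
    exact hmono k (j + 1) (by omega)
  refine ⟨y, hyS 0, fun z hz => ?_⟩
  by_contra hcon
  push Not at hcon
  apply hz
  have hzS : ∀ k, z ∈ S (x k) := fun k => htrans _ _ _ (hyS k) hcon
  have h0 : Tendsto (fun k => dist (x (k + 1)) z) atTop (𝓝 0) := by
    refine squeeze_zero (fun _ => dist_nonneg) (fun k => hclose k z (hzS (k + 1))) ?_
    have := (tendsto_pow_atTop_nhds_zero_of_lt_one (r := (1 / 2 : ℝ)) (by norm_num)
      (by norm_num)).const_mul (1 / σ)
    simpa using this
  exact tendsto_nhds_unique (tendsto_iff_dist_tendsto_zero.2 h0) hy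

variable {X : Type*} [NormedAddCommGroup X] [NormedSpace ℝ X]

def Cov (n : ℕ) (A : Set X) : Prop :=
  ∃ U : Fin n → Set X, (∀ i, IsOpen (U i)) ∧ (∀ i, ∀ x ∈ U i, -x ∉ U i) ∧
    ∀ x ∈ A, ∃ i, x ∈ U i ∨ -x ∈ U i

def Lam (J : X → ℝ) (h : X → X) : Prop :=
  Continuous h ∧ (∀ x, h (-x) = - h x) ∧ ∀ x, J x ≤ 0 → h x = x

def Gam (J : X → ℝ) (ρ : ℝ) (n : ℕ) : Set (NonemptyCompacts X) :=
  {A | ∀ h, Lam J h → ¬ Cov n {x | x ∈ A ∧ ‖h x‖ = ρ}}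

lemma isClosed_Gam (J : X → ℝ) (ρ : ℝ) (n : ℕ) : IsClosed (Gam J ρ n) := by
  rw [← isOpen_compl_iff, isOpen_iff_mem_nhds]
  intro A hA
  simp only [Gam, Set.mem_compl_iff, Set.mem_ofPred_eq, not_forall, not_not] at hA
  obtain ⟨h, hh, U, hU, hUd, hc⟩ := hA
  let O : Set X := (⋃ i, (U i ∪ (fun x => -x) ⁻¹' U i)) ∪ {x | ‖h x‖ ≠ ρ}
  have hO : IsOpen O := by
    apply IsOpen.union
    · exact isOpen_iUnion fun i => (hU i).union ((hU i).preimage continuous_neg)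
    · exact isOpen_ne_fun hh.1.norm continuous_const
  have hAO : (A : Set X) ⊆ O := by
    intro x hx
    by_cases hxr : ‖h x‖ = ρ
    · left
      obtain ⟨i, hi⟩ := hc x ⟨hx, hxr⟩
      exact Set.mem_iUnion.2 ⟨i, hi⟩
    · right; exact hxr
  have := (NonemptyCompacts.isOpen_subsets_of_isOpen hO).mem_nhds hAO
  filter_upwards [this] with B hB
  simp only [Gam, Set.mem_compl_iff, Set.mem_ofPred_eq, not_forall, not_not]
  refine ⟨h, hh, U, hU, hUd, ?_⟩
  rintro x ⟨hx, hxr⟩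
  rcases hB hx with h' | h'
  · exact Set.mem_iUnion.1 h'
  · exact absurd hxr h'

lemma Gam_map {J : X → ℝ} {ρ : ℝ} {n : ℕ} {A : NonemptyCompacts X} (hA : A ∈ Gam J ρ n)
    {η : X → X} (hη : Lam J η) : A.map η hη.1 ∈ Gam J ρ n := by
  rintro h hh ⟨U, hU, hUd, hc⟩
  refine hA (h ∘ η) ⟨hh.1.comp hη.1, fun x => by simp [hη.2.1, hh.2.1], fun x hx => ?_⟩
    ⟨fun i => η ⁻¹' U i, fun i => (hU i).preimage hη.1, fun i x hx => ?_, ?_⟩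
  · simp [hη.2.2 x hx, hh.2.2 x hx]
  · simp only [Set.mem_preimage, hη.2.1]; exact hUd i _ hx
  · rintro x ⟨hx, hxr⟩
    obtain ⟨i, hi⟩ := hc (η x) ⟨by
      rw [← SetLike.mem_coe, NonemptyCompacts.coe_map]; exact ⟨x, hx, rfl⟩, hxr⟩
    exact ⟨i, by simpa [hη.2.1] using hi⟩

lemma lam_id (J : X → ℝ) : Lam J (fun x => x) := ⟨continuous_id, fun _ => rfl, fun _ _ => rfl⟩

lemma Cov_empty (n : ℕ) : Cov n (∅ : Set X) :=
  ⟨fun _ => ∅, fun _ => isOpen_empty, fun _ _ h => absurd h (Set.notMem_empty _),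
    fun _ h => absurd h (Set.notMem_empty _)⟩

lemma Gam_sphere {J : X → ℝ} {ρ : ℝ} {n : ℕ} {A : NonemptyCompacts X} (hA : A ∈ Gam J ρ n) :
    ∃ x ∈ A, ‖x‖ = ρ := by
  by_contra hcon
  push Not at hcon
  apply hA _ (lam_id J)
  have : {x | x ∈ A ∧ ‖x‖ = ρ} = ∅ := by
    ext x; simpa using hcon x
  rw [this]; exact Cov_empty n

lemma Gam_diff {J : X → ℝ} {ρ : ℝ} {n q : ℕ} {A : NonemptyCompacts X} (hA : A ∈ Gam J ρ (n + q))
    {N : Set X} (hN : IsOpen N) (hq : Cov q N) :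
    ∃ B ∈ Gam J ρ n, ∀ x, x ∈ B ↔ x ∈ A ∧ x ∉ N := by
  have key : ∀ h, Lam J h → ¬ Cov n {x | (x ∈ A ∧ x ∉ N) ∧ ‖h x‖ = ρ} := by
    rintro h hh ⟨U, hU, hUd, hc⟩
    obtain ⟨U', hU', hUd', hc'⟩ := hq
    apply hA h hh
    refine ⟨Fin.append U U', fun i => ?_, fun i => ?_, ?_⟩
    · refine Fin.addCases (fun i => ?_) (fun i => ?_) i
      · simpa using hU i
      · simpa using hU' i
    · refine Fin.addCases (fun i => ?_) (fun i => ?_) i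
      · simpa using hUd i
      · simpa using hUd' i
    · rintro x ⟨hx, hxr⟩
      by_cases hxN : x ∈ N
      · obtain ⟨i, hi⟩ := hc' x hxN
        exact ⟨Fin.natAdd n i, by simpa using hi⟩
      · obtain ⟨i, hi⟩ := hc x ⟨⟨hx, hxN⟩, hxr⟩
        exact ⟨Fin.castAdd q i, by simpa using hi⟩
  have hne : ((A : Set X) \ N).Nonempty := by
    by_contra hcon
    rw [Set.not_nonempty_iff_eq_empty] at hcon
    apply key _ (lam_id J)
    have : {x | (x ∈ A ∧ x ∉ N) ∧ ‖x‖ = ρ} = ∅ := by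
      ext x
      simp only [Set.mem_ofPred_eq, Set.mem_empty_iff_false, iff_false]
      rintro ⟨⟨h1, h2⟩, -⟩
      have : x ∈ (A : Set X) \ N := ⟨h1, h2⟩
      rw [hcon] at this; exact this
    rw [this]; exact Cov_empty n
  exact ⟨⟨⟨(A : Set X) \ N, A.isCompact.diff hN⟩, hne⟩, key, fun x => Iff.rfl⟩

lemma Gam_nonempty (hinf : ¬ FiniteDimensional ℝ X) (J : X → ℝ) (ρ : ℝ) (hρ : 0 < ρ)
    (hfin : ∀ Y : Submodule ℝ X, FiniteDimensional ℝ Y →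
      ∃ R : ℝ, 0 < R ∧ ∀ u ∈ Y, R ≤ ‖u‖ → J u ≤ 0) (n : ℕ) : (Gam J ρ n).Nonempty := by
  obtain ⟨b, hb⟩ : ∃ b : Fin (n + 1) → X, LinearIndependent ℝ b := by
    let B := Module.Basis.ofVectorSpace ℝ X
    have : Infinite (Module.Basis.ofVectorSpaceIndex ℝ X) := by
      by_contra h
      rw [not_infinite_iff_finite] at h
      exact hinf (Module.Finite.of_basis B)
    let e := Infinite.natEmbedding (Module.Basis.ofVectorSpaceIndex ℝ X)
    exact ⟨fun i => B (e i), B.linearIndependent.comp (fun i : Fin (n + 1) => e i)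
      (fun i j h => Fin.ext (e.injective h))⟩
  let L : (Fin (n + 1) → ℝ) →ₗ[ℝ] X := Fintype.linearCombination ℝ b
  have hLinj : LinearMap.ker L = ⊥ :=
    LinearMap.ker_eq_bot.2 hb.fintypeLinearCombination_injective
  have hLc : Continuous L := L.continuous_of_finiteDimensional
  obtain ⟨K, hK, hKL⟩ := L.exists_antilipschitzWith hLinj
  obtain ⟨RY, hRY, hJ⟩ := hfin (LinearMap.range L) inferInstance
  set R : ℝ := K * max RY ρ with hRdef
  have hK' : (0 : ℝ) < K := by exact_mod_cast hK
  have hR : ∀ c, R ≤ ‖c‖ → max RY ρ ≤ ‖L c‖ := by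
    intro c hc
    have h := hKL.le_mul_dist c 0
    rw [dist_zero_right, map_zero, dist_zero_right] at h
    exact le_of_mul_le_mul_left (hc.trans h) hK'
  refine ⟨⟨⟨L '' Metric.closedBall 0 (R + 1), (isCompact_closedBall _ _).image hLc⟩,
    ⟨L 0, 0, by simp; positivity, rfl⟩⟩, ?_⟩
  rintro h hh ⟨U, hU, hUd, hc⟩
  refine coordBU n (fun c => ‖h (L c)‖) (hh.1.comp hLc).norm (fun c => by simp [hh.2.1]) ρ R ?_ ?_
    (fun i => L ⁻¹' U i) (fun i => (hU i).preimage hLc)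
    (fun i x hx => by simpa using hUd i _ hx) ?_
  · have : h 0 = 0 := by
      have h1 := hh.2.1 0
      rw [neg_zero] at h1
      have h2 : (2 : ℝ) • h 0 = 0 := by
        rw [two_smul]; nth_rewrite 1 [h1]; simp
      simpa using h2
    simpa [this] using hρ
  · intro c hcR
    have h1 := hR c hcR
    have h2 : J (L c) ≤ 0 := hJ _ ⟨c, rfl⟩ ((le_max_left _ _).trans h1)
    simp only [hh.2.2 _ h2]
    exact (le_max_right _ _).trans h1
  · intro x hx hxr
    obtain ⟨i, hi⟩ := hc (L x) ⟨⟨x, by simpa using hx, rfl⟩, hxr⟩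
    exact ⟨i, by simpa using hi⟩

noncomputable def Phi (J : X → ℝ) (A : NonemptyCompacts X) : ℝ := sSup (J '' A)

lemma Phi_spec {J : X → ℝ} (hJ : Continuous J) (A : NonemptyCompacts X) :
    (∃ x ∈ A, J x = Phi J A) ∧ ∀ y ∈ A, J y ≤ Phi J A := by
  obtain ⟨x, hx, h⟩ := A.isCompact.exists_sSup_image_eq A.nonempty hJ.continuousOn
  refine ⟨⟨x, hx, h.symm⟩, fun y hy => ?_⟩
  exact le_csSup (A.isCompact.image hJ).bddAbove ⟨y, hy, rfl⟩

lemma Phi_lsc {J : X → ℝ} (hJ : Continuous J) : LowerSemicontinuous (Phi J) := by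
  intro A a ha
  obtain ⟨⟨x, hx, hxA⟩, -⟩ := Phi_spec hJ A
  have hO : IsOpen {x | a < J x} := isOpen_lt continuous_const hJ
  have := (NonemptyCompacts.isOpen_inter_nonempty_of_isOpen hO).mem_nhds
    (show ((A : Set X) ∩ {x | a < J x}).Nonempty from ⟨x, hx, by simpa [hxA] using ha⟩)
  filter_upwards [this] with B hB
  obtain ⟨y, hy, hya⟩ := hB
  exact lt_of_lt_of_le hya ((Phi_spec hJ B).2 y hy)

lemma deriv_odd {J : X → ℝ} {J' : X → X →L[ℝ] ℝ} (hJdiff : ∀ u, HasFDerivAt J (J' u) u)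
    (heven : ∀ u : X, J (-u) = J u) (u : X) : J' (-u) = - J' u := by
  have h1 : HasFDerivAt (fun x : X => J (-x)) ((J' (-u)).comp (-ContinuousLinearMap.id ℝ X)) u :=
    (hJdiff (-u)).comp u (hasFDerivAt_id u).neg
  have h2 : (fun x : X => J (-x)) = J := funext heven
  rw [h2] at h1
  have h3 := h1.unique (hJdiff u)
  rw [← h3]
  ext v; simp

lemma descent {J : X → ℝ} {J' : X → X →L[ℝ] ℝ} (hJdiff : ∀ u, HasFDerivAt J (J' u) u)
    (hJ'cont : Continuous J') (heven : ∀ u : X, J (-u) = J u)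
    (A : NonemptyCompacts X) (hpos : 0 < Phi J A) (σ : ℝ) (hσ : 0 < σ)
    (hA : ∀ u ∈ A, J u = Phi J A → σ < ‖J' u‖) :
    ∃ t > 0, ∃ η, Lam J η ∧ (∀ x, dist (η x) x ≤ t) ∧ ∀ x ∈ A, J (η x) ≤ Phi J A - σ * t := by
  have hJc : Continuous J := continuous_iff_continuousAt.2 fun u => (hJdiff u).continuousAt
  have hodd := deriv_odd hJdiff heven
  let M : Set X := {x | (x ∈ (A : Set X) ∨ -x ∈ (A : Set X)) ∧ J x = Phi J A}
  have hM : IsClosed M := by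
    apply IsClosed.inter
    · exact A.isCompact.isClosed.union (A.isCompact.isClosed.preimage continuous_neg)
    · exact isClosed_eq hJc continuous_const
  have hMn : ∀ x, x ∈ M → -x ∈ M := by
    rintro x ⟨h1, h2⟩
    exact ⟨by simpa using h1.symm, by rw [heven, h2]⟩
  have hMσ : ∀ x ∈ M, σ < ‖J' x‖ := by
    rintro x ⟨h1 | h1, h2⟩
    · exact hA x h1 h2
    · have := hA (-x) h1 (by rw [heven, h2])
      rwa [hodd, norm_neg] at this
  obtain ⟨g, hg⟩ := exists_continuous_forall_mem_convex_of_local_const (X := X) (E := X)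
    (t := fun x => {v | ‖v‖ ≤ 1 ∧ (x ∈ M → σ < J' x v) ∧ (J x ≤ 0 → v = 0)})
    (by
      intro x
      have h1 : Convex ℝ {v : X | ‖v‖ ≤ 1} := by
        simpa [Metric.closedBall] using convex_closedBall (0 : X) 1
      have h2 : Convex ℝ {v : X | x ∈ M → σ < J' x v} := by
        by_cases hx : x ∈ M
        · simp only [hx, true_imp_iff]
          exact convex_halfSpace_gt (J' x).toLinearMap.isLinear σ
        · simp [hx, convex_univ]
      have h3 : Convex ℝ {v : X | J x ≤ 0 → v = 0} := by
        by_cases hx : J x ≤ 0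
        · simp [hx, convex_singleton]
        · simp [hx, convex_univ]
      exact h1.inter (h2.inter h3))
    (by
      intro x
      by_cases hx : x ∈ M
      · obtain ⟨v, hv1, hv2⟩ : ∃ v : X, ‖v‖ ≤ 1 ∧ σ < J' x v := by
          obtain ⟨v, hv, hv'⟩ := (J' x).exists_lt_apply_of_lt_opNorm (hMσ x hx)
          rw [Real.norm_eq_abs, lt_abs] at hv'
          rcases hv' with h | h
          · exact ⟨v, hv.le, h⟩
          · exact ⟨-v, by simpa using hv.le, by simpa using h⟩
        refine ⟨v, ?_⟩
        have c1 : Continuous fun y => J' y v := hJ'cont.clm_apply continuous_const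
        have e1 := c1.continuousAt.eventually (lt_mem_nhds hv2)
        have e2 := hJc.continuousAt.eventually (lt_mem_nhds (show 0 < J x by rw [hx.2]; exact hpos))
        filter_upwards [e1, e2] with y hy1 hy2
        exact ⟨hv1, fun _ => hy1, fun h => absurd h (not_le.2 hy2)⟩
      · refine ⟨0, ?_⟩
        filter_upwards [hM.isOpen_compl.mem_nhds hx] with y hy
        exact ⟨by simp, fun h => absurd h hy, fun _ => rfl⟩)
  let V : X → X := fun x => (1 / 2 : ℝ) • (g x - g (-x))
  have hVc : Continuous V := by
    have := g.continuous
    fun_prop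
  have hVodd : ∀ x, V (-x) = - V x := by
    intro x; simp only [V, neg_neg, ← smul_neg, neg_sub]
  have hV1 : ∀ x, ‖V x‖ ≤ 1 := by
    intro x
    simp only [V]
    rw [norm_smul]
    have := norm_sub_le (g x) (g (-x))
    have h1 := (hg x).1
    have h2 := (hg (-x)).1
    rw [Real.norm_of_nonneg (by norm_num)]
    linarith
  have hV2 : ∀ x ∈ M, σ < J' x (V x) := by
    intro x hx
    have h1 := (hg x).2.1 hx
    have h2 := (hg (-x)).2.1 (hMn x hx)
    rw [hodd, neg_apply] at h2
    simp only [V, map_smul, map_sub, smul_eq_mul]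
    linarith
  have hV3 : ∀ x, J x ≤ 0 → V x = 0 := by
    intro x hx
    have h1 := (hg x).2.2 hx
    have h2 := (hg (-x)).2.2 (by rwa [heven])
    simp [V, h1, h2]
  have hev : ∀ᶠ t in 𝓝 (0 : ℝ), ∀ x ∈ (A : Set X), 0 < t → x ∈ A →
      J (x - t • V x) ≤ Phi J A - σ * t := by
    apply A.isCompact.eventually_forall_of_forall_eventually
    intro x hx
    have hct : Continuous fun z : ℝ × X => z.2 - z.1 • V z.2 := by fun_prop
    rcases lt_or_eq_of_le ((Phi_spec hJc A).2 x hx) with hlt | heq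
    · have c1 : Continuous fun z : ℝ × X => J (z.2 - z.1 • V z.2) + σ * z.1 := by fun_prop
      have h0 : (fun z : ℝ × X => J (z.2 - z.1 • V z.2) + σ * z.1) ((0 : ℝ), x) < Phi J A := by
        simpa using hlt
      have := (c1.continuousAt (x := ((0 : ℝ), x))).eventually (gt_mem_nhds h0)
      filter_upwards [this] with z hz _ _
      linarith
    · have hxM : x ∈ M := ⟨Or.inl hx, heq⟩
      have hs : HasStrictFDerivAt J (J' x) x :=
        hasStrictFDerivAt_of_hasFDerivAt_of_continuousAt
          (Eventually.of_forall hJdiff) hJ'cont.continuousAt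
      set κ := (J' x (V x) - σ) / 2 with hκ
      have hκ0 : 0 < κ := by have := hV2 x hxM; linarith
      have h1 := hs.isLittleO.def hκ0
      have hpair : Tendsto (fun z : ℝ × X => (z.2 - z.1 • V z.2, z.2)) (𝓝 ((0 : ℝ), x))
          (𝓝 (x, x)) := by
        have : Continuous fun z : ℝ × X => (z.2 - z.1 • V z.2, z.2) := by fun_prop
        have h := this.tendsto ((0 : ℝ), x)
        simpa using h
      have h2 := hpair.eventually h1
      have c3 : Continuous fun z : ℝ × X => J' x (V z.2) := by fun_prop
      have h3 := (c3.continuousAt (x := ((0 : ℝ), x))).eventually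
        (lt_mem_nhds (a := σ + κ) (by simp only; linarith))
      filter_upwards [h2, h3] with z hz2 hz3 hz0 hzA
      have hJz := (Phi_spec hJc A).2 z.2 hzA
      simp only [sub_sub_cancel_left, map_neg, map_smul, smul_eq_mul, norm_neg, norm_smul] at hz2
      rw [Real.norm_eq_abs, Real.norm_eq_abs, abs_of_pos hz0] at hz2
      have h4 := (abs_le.1 hz2).2
      have h5 := hV1 z.2
      have h6 : κ * (z.1 * ‖V z.2‖) ≤ κ * z.1 := by
        apply mul_le_mul_of_nonneg_left _ hκ0.le
        nlinarith
      nlinarith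
  obtain ⟨t, ht, ht0⟩ := ((hev.filter_mono nhdsWithin_le_nhds).and
    (self_mem_nhdsWithin : Set.Ioi (0 : ℝ) ∈ 𝓝[>] 0)).exists
  have ht0' : 0 < t := ht0
  refine ⟨t, ht0', fun x => x - t • V x, ⟨by fun_prop, fun x => ?_, fun x hx => ?_⟩, fun x => ?_,
    fun x hx => ht x hx ht0' hx⟩
  · simp only [hVodd, smul_neg]; abel
  · simp [hV3 x hx]
  · rw [dist_eq_norm, sub_sub_cancel_left, norm_neg, norm_smul, Real.norm_of_nonneg ht0'.le]
    nlinarith [hV1 x]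

end vari
end SMP
namespace SMP
section fin
open TopologicalSpace
variable {X : Type*} [NormedAddCommGroup X] [NormedSpace ℝ X]

lemma exists_cov {K : Set X} (hK : IsCompact K) (h0 : (0 : X) ∉ K) :
    ∃ q : ℕ, ∃ r > 0, Cov q (Metric.thickening r K) := by
  obtain ⟨s, hsK, hs⟩ := hK.elim_nhds_subcover (fun u => Metric.ball u (‖u‖ / 2)) (fun u hu => by
    apply Metric.ball_mem_nhds
    have : u ≠ 0 := fun h => h0 (h ▸ hu)
    positivity)
  obtain ⟨r, hr, hsub⟩ := hK.exists_thickening_subset_open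
    (isOpen_biUnion (fun u (_ : u ∈ s) => Metric.isOpen_ball)) hs
  refine ⟨s.card, r, hr, fun i => Metric.ball (s.equivFin.symm i : X) (‖(s.equivFin.symm i : X)‖ / 2),
    fun i => Metric.isOpen_ball, ?_, ?_⟩
  · intro i x hx hx'
    change x ∈ Metric.ball (s.equivFin.symm i : X) (‖(s.equivFin.symm i : X)‖ / 2) at hx
    change -x ∈ Metric.ball (s.equivFin.symm i : X) (‖(s.equivFin.symm i : X)‖ / 2) at hx'
    generalize (s.equivFin.symm i : X) = u at hx hx'
    rw [Metric.mem_ball, dist_eq_norm] at hx hx'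
    have h1 : ‖(x - u) + (-x - u)‖ ≤ ‖x - u‖ + ‖-x - u‖ := norm_add_le _ _
    have h2 : (x - u) + (-x - u) = (-2 : ℝ) • u := by
      rw [neg_smul, two_smul]; abel
    rw [h2, norm_smul] at h1
    norm_num at h1
    linarith [norm_nonneg u]
  · intro x hx
    have := hsub hx
    simp only [Set.mem_iUnion] at this
    obtain ⟨u, hu, hxu⟩ := this
    refine ⟨s.equivFin ⟨u, hu⟩, Or.inl ?_⟩
    simpa using hxu

lemma minimax [CompleteSpace X]
    (J : X → ℝ) (J' : X → X →L[ℝ] ℝ)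
    (hJdiff : ∀ u, HasFDerivAt J (J' u) u) (hJ'cont : Continuous J')
    (hPS : ∀ c : ℝ, ∀ u : ℕ → X,
      Tendsto (fun j => J (u j)) atTop (𝓝 c) →
      Tendsto (fun j => ‖J' (u j)‖) atTop (𝓝 0) →
      ∃ φ : ℕ → ℕ, StrictMono φ ∧ ∃ x : X,
        Tendsto (fun j => u (φ j)) atTop (𝓝 x))
    (ρ δ : ℝ) (hδ : 0 < δ)
    (hMP1 : ∀ u : X, ‖u‖ = ρ → δ ≤ J u)
    (heven : ∀ u : X, J (-u) = J u)
    (c : ℝ) (q : ℕ) (r : ℝ) (hr : 0 < r)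
    (hcov : Cov q (Metric.thickening r {u | J u = c ∧ J' u = 0}))
    (hc : ∀ ε > 0, ∃ n, (∀ B ∈ Gam J ρ n, c - ε ≤ Phi J B) ∧
      ∃ A ∈ Gam J ρ (n + q), Phi J A ≤ c + ε) : False := by
  have hJc : Continuous J := continuous_iff_continuousAt.2 fun u => (hJdiff u).continuousAt
  set K : Set X := {u | J u = c ∧ J' u = 0} with hKdef
  have key : ∀ σ > 0, ∃ u a : X, |J u - c| ≤ σ ^ 2 / 2 ∧ ‖J' u‖ ≤ σ ∧ dist u a < 2 * σ ∧
      a ∉ Metric.thickening r K := by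
    intro σ hσ
    obtain ⟨n, hn, A, hA, hAc⟩ := hc (σ ^ 2 / 2) (by positivity)
    obtain ⟨B, hB, hBA⟩ := Gam_diff hA Metric.isOpen_thickening hcov
    have hBc : Phi J B ≤ c + σ ^ 2 / 2 := by
      obtain ⟨⟨x, hx, hxB⟩, -⟩ := Phi_spec hJc B
      rw [← hxB]
      exact ((Phi_spec hJc A).2 x ((hBA x).1 hx).1).trans hAc
    have : CompleteSpace (Gam J ρ n) := (isClosed_Gam J ρ n).completeSpace_coe
    obtain ⟨⟨C, hC⟩, hC1, hC2⟩ := ekeland (Y := Gam J ρ n) (fun A => Phi J A.1)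
      ((Phi_lsc hJc).comp continuous_subtype_val) (c - σ ^ 2 / 2) (fun y => hn y.1 y.2) σ hσ ⟨B, hB⟩
    simp only [Subtype.dist_eq] at hC1 hC2
    have hClow := hn C hC
    have hd : dist B C ≤ σ := by
      have : σ * dist B C ≤ σ * σ := by nlinarith
      exact le_of_mul_le_mul_left this hσ
    have hCpos : 0 < Phi J C := by
      obtain ⟨x, hx, hxr⟩ := Gam_sphere hC
      linarith [hMP1 x hxr, (Phi_spec hJc C).2 x hx]
    obtain ⟨u, huC, hu1, hu2⟩ : ∃ u ∈ C, J u = Phi J C ∧ ‖J' u‖ ≤ σ := by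
      by_contra hcon
      push Not at hcon
      obtain ⟨t, ht, η, hη, hηd, hηJ⟩ := descent hJdiff hJ'cont heven C hCpos σ hσ hcon
      have hD := Gam_map hC hη
      have hDphi : Phi J (C.map η hη.1) ≤ Phi J C - σ * t := by
        obtain ⟨⟨x, hx, hxB⟩, -⟩ := Phi_spec hJc (C.map η hη.1)
        rw [← hxB]
        rw [← SetLike.mem_coe, NonemptyCompacts.coe_map] at hx
        obtain ⟨y, hy, rfl⟩ := hx
        exact hηJ y hy
      have hDd : dist C (C.map η hη.1) ≤ t := by
        rw [Metric.NonemptyCompacts.dist_eq]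
        apply Metric.hausdorffDist_le_of_mem_dist ht.le
        · intro x hx
          refine ⟨η x, ?_, by rw [dist_comm]; exact hηd x⟩
          rw [NonemptyCompacts.coe_map]; exact ⟨x, hx, rfl⟩
        · intro x hx
          rw [NonemptyCompacts.coe_map] at hx
          obtain ⟨y, hy, rfl⟩ := hx
          exact ⟨y, hy, hηd y⟩
      have hσt : 0 < σ * t := by positivity
      have hne : (⟨C.map η hη.1, hD⟩ : Gam J ρ n) ≠ ⟨C, hC⟩ := by
        intro h
        have h' : C.map η hη.1 = C := congrArg Subtype.val h
        rw [h'] at hDphi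
        linarith
      have := hC2 _ hne
      nlinarith
    have hdist : Metric.hausdorffDist (C : Set X) (B : Set X) < 2 * σ := by
      rw [← Metric.NonemptyCompacts.dist_eq, dist_comm]; linarith
    obtain ⟨a, ha, hua⟩ := Metric.exists_dist_lt_of_hausdorffDist_lt huC hdist
      (Metric.hausdorffEDist_ne_top_of_nonempty_of_bounded C.nonempty B.nonempty
        C.isCompact.isBounded B.isCompact.isBounded)
    refine ⟨u, a, ?_, hu2, hua, ((hBA a).1 ha).2⟩
    rw [hu1, abs_le]
    have : 0 ≤ σ * dist B C := by positivity
    constructor <;> linarith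
  have hσ : ∀ k : ℕ, (0 : ℝ) < 1 / ((k : ℝ) + 1) := fun k => by positivity
  choose u a h1 h2 h3 h4 using fun k : ℕ => key (1 / ((k : ℝ) + 1)) (hσ k)
  have hlim : Tendsto (fun k : ℕ => 1 / ((k : ℝ) + 1)) atTop (𝓝 0) :=
    tendsto_one_div_add_atTop_nhds_zero_nat
  have t1 : Tendsto (fun j => J (u j)) atTop (𝓝 c) := by
    rw [tendsto_iff_dist_tendsto_zero]
    refine squeeze_zero (fun _ => dist_nonneg) (fun k => h1 k) ?_
    simpa using (hlim.pow 2).div_const 2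
  have t2 : Tendsto (fun j => ‖J' (u j)‖) atTop (𝓝 0) :=
    squeeze_zero (fun _ => norm_nonneg _) h2 hlim
  obtain ⟨φ, hφ, x, hx⟩ := hPS c u t1 t2
  have hxK : x ∈ K := by
    constructor
    · exact tendsto_nhds_unique ((hJc.tendsto x).comp hx) (t1.comp hφ.tendsto_atTop)
    · have := tendsto_nhds_unique ((hJ'cont.norm.tendsto x).comp hx) (t2.comp hφ.tendsto_atTop)
      exact norm_eq_zero.1 this
  have t3 : Tendsto (fun j => dist (u (φ j)) x + 2 * (1 / (((φ j : ℕ) : ℝ) + 1))) atTop (𝓝 0) := by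
    have e1 := tendsto_iff_dist_tendsto_zero.1 hx
    have e2 := (hlim.comp hφ.tendsto_atTop).const_mul 2
    simpa using e1.add e2
  obtain ⟨j, hj⟩ := (t3.eventually (gt_mem_nhds hr)).exists
  apply h4 (φ j)
  rw [Metric.mem_thickening_iff]
  refine ⟨x, hxK, ?_⟩
  have := h3 (φ j)
  have := dist_triangle_left (a (φ j)) x (u (φ j))
  linarith

end fin
end SMP

theorem statement18 {X : Type*} [NormedAddCommGroup X] [NormedSpace ℝ X]
    [CompleteSpace X] (hinf : ¬ FiniteDimensional ℝ X)
    (J : X → ℝ) (J' : X → X →L[ℝ] ℝ)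
    (hJdiff : ∀ u, HasFDerivAt J (J' u) u) (hJ'cont : Continuous J')
    (hPS : ∀ c : ℝ, ∀ u : ℕ → X,
      Tendsto (fun j => J (u j)) atTop (𝓝 c) →
      Tendsto (fun j => ‖J' (u j)‖) atTop (𝓝 0) →
      ∃ φ : ℕ → ℕ, StrictMono φ ∧ ∃ x : X,
        Tendsto (fun j => u (φ j)) atTop (𝓝 x))
    (hJ0 : J 0 = 0)
    (ρ δ : ℝ) (hρ : 0 < ρ) (hδ : 0 < δ)
    (hMP1 : ∀ u : X, ‖u‖ = ρ → δ ≤ J u)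
    (heven : ∀ u : X, J (-u) = J u)
    (hfin : ∀ Y : Submodule ℝ X, FiniteDimensional ℝ Y →
      ∃ R : ℝ, 0 < R ∧ ∀ u ∈ Y, R ≤ ‖u‖ → J u ≤ 0) :
    ∃ u : ℕ → X, (∀ m, J' (u m) = 0) ∧
      Tendsto (fun m => J (u m)) atTop atTop := by
  have hJc : Continuous J := continuous_iff_continuousAt.2 fun u => (hJdiff u).continuousAt
  suffices H : ∀ M : ℝ, ∃ u, J' u = 0 ∧ M < J u by
    choose u hu1 hu2 using fun m : ℕ => H m
    exact ⟨u, hu1, tendsto_atTop_mono (fun m => (hu2 m).le) tendsto_natCast_atTop_atTop⟩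
  by_contra hcon
  push Not at hcon
  obtain ⟨M, hM⟩ := hcon
  have hmm := SMP.minimax J J' hJdiff hJ'cont hPS ρ δ hδ hMP1 heven
  let c : ℕ → ℝ := fun n => sInf (SMP.Phi J '' SMP.Gam J ρ n)
  have hlow : ∀ n, ∀ A ∈ SMP.Gam J ρ n, δ ≤ SMP.Phi J A := by
    intro n A hA
    obtain ⟨x, hx, hxr⟩ := SMP.Gam_sphere hA
    exact (hMP1 x hxr).trans ((SMP.Phi_spec hJc A).2 x hx)
  have hne : ∀ n, (SMP.Phi J '' SMP.Gam J ρ n).Nonempty := fun n =>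
    (SMP.Gam_nonempty hinf J ρ hρ hfin n).image _
  have hc1 : ∀ n, ∀ A ∈ SMP.Gam J ρ n, c n ≤ SMP.Phi J A := fun n A hA =>
    csInf_le ⟨δ, by rintro _ ⟨B, hB, rfl⟩; exact hlow n B hB⟩ ⟨A, hA, rfl⟩
  have hc2 : ∀ n, ∀ ε > 0, ∃ A ∈ SMP.Gam J ρ n, SMP.Phi J A ≤ c n + ε := by
    intro n ε hε
    obtain ⟨_, ⟨A, hA, rfl⟩, h⟩ := exists_lt_of_csInf_lt (hne n) (show c n < c n + ε by linarith)
    exact ⟨A, hA, h.le⟩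
  have hc3 : ∀ n, δ ≤ c n := fun n =>
    le_csInf (hne n) (by rintro _ ⟨B, hB, rfl⟩; exact hlow n B hB)
  by_cases hcase : ∃ n, M < c n
  · obtain ⟨n, hn⟩ := hcase
    have hK : {u | J u = c n ∧ J' u = 0} = ∅ := by
      ext u
      simp only [Set.mem_ofPred_eq, Set.mem_empty_iff_false, iff_false]
      rintro ⟨h1, h2⟩
      have := hM u h2
      linarith
    refine hmm (c n) 0 1 one_pos ?_ ?_
    · rw [hK, Metric.thickening_empty]; exact SMP.Cov_empty 0
    · intro ε hε
      exact ⟨n, fun B hB => by linarith [hc1 n B hB], hc2 n ε hε⟩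
  · push Not at hcase
    have hbdd : BddAbove (Set.range c) := ⟨M, by rintro _ ⟨n, rfl⟩; exact hcase n⟩
    set C := ⨆ n, c n with hC
    have hCle : ∀ n, c n ≤ C := fun n => le_ciSup hbdd n
    have hKc : IsCompact {u | J u = C ∧ J' u = 0} := by
      apply IsSeqCompact.isCompact
      intro u hu
      obtain ⟨φ, hφ, x, hx⟩ := hPS C u
        (by simp only [fun j => (hu j).1]; exact tendsto_const_nhds)
        (by simp only [fun j => (hu j).2, norm_zero]; exact tendsto_const_nhds)
      refine ⟨x, ⟨?_, ?_⟩, φ, hφ, hx⟩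
      · refine tendsto_nhds_unique ((hJc.tendsto x).comp hx) ?_
        have : J ∘ (fun j => u (φ j)) = fun _ => C := funext fun j => (hu (φ j)).1
        rw [this]; exact tendsto_const_nhds
      · refine tendsto_nhds_unique ((hJ'cont.tendsto x).comp hx) ?_
        have : J' ∘ (fun j => u (φ j)) = fun _ => 0 := funext fun j => (hu (φ j)).2
        rw [this]; exact tendsto_const_nhds
    obtain ⟨q, r, hr, hcov⟩ := SMP.exists_cov hKc (by
      rintro ⟨h1, -⟩
      rw [hJ0] at h1
      linarith [hc3 0, hCle 0])
    refine hmm C q r hr hcov ?_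
    intro ε hε
    obtain ⟨n, hn⟩ := exists_lt_of_lt_ciSup (show C - ε < ⨆ n, c n by rw [← hC]; linarith)
    obtain ⟨A, hA, hA'⟩ := hc2 (n + q) ε hε
    exact ⟨n, fun B hB => by linarith [hc1 n B hB], A, hA, by linarith [hCle (n + q)]⟩
end
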